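/- arXiv:2506.07939 — 9 statements merged into one kernel-verified Lean document; each statement's English description precedes it below -/
import Mathlib

section
/- Fix α ∈ ℝ and T > 0. There exists a constant C = C(α,T) > 0 such that for all x, y ≥ 0 and all t ∈ (0, T], one has C⁻¹ · 𝔭_t(x−y) ≤ p_t^α(x,y) ≤ C · 𝔭_t(x−y). -/
open MeasureTheory

/-- The standard Gaussian heat kernel `𝔭_s(u) = (2πs)^{-1/2} exp(-u²/(2s))`. -/
noncomputable def heatKernel (s u : ℝ) : ℝ :=
  (Real.sqrt (2 * Real.pi * s))⁻¹ * Real.exp (-(u ^ 2) / (2 * s))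

/-- The Robin heat kernel
`p_t^α(x,y) = 𝔭_t(x+y) + 𝔭_t(x−y) − 2(α − 1/2) ∫₀^∞ 𝔭_t(x+y+z) e^{−(α−1/2)z} dz`. -/
noncomputable def robinKernel (α t x y : ℝ) : ℝ :=
  heatKernel t (x + y) + heatKernel t (x - y) -
    2 * (α - 1 / 2) *
      ∫ z in Set.Ioi (0 : ℝ), heatKernel t (x + y + z) * Real.exp (-(α - 1 / 2) * z)

lemma heatKernel_nonneg (s u : ℝ) : 0 ≤ heatKernel s u := by
  unfold heatKernel; positivity

lemma robin_integrable (a T : ℝ) (hT : 0 < T) :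
    Integrable (fun z : ℝ => Real.exp (-(z ^ 2) / (2 * T)) * Real.exp (-a * z)) := by
  have h1 : Integrable (fun z : ℝ => Real.exp (T * a ^ 2) * Real.exp (-(1 / (4 * T)) * z ^ 2)) :=
    (integrable_exp_neg_mul_sq (by positivity)).const_mul _
  refine h1.mono' (by fun_prop) (Filter.Eventually.of_forall fun z => ?_)
  rw [Real.norm_of_nonneg (by positivity), ← Real.exp_add, ← Real.exp_add]
  apply Real.exp_le_exp.2
  have : T * a ^ 2 + -(1 / (4 * T)) * z ^ 2 - (-(z ^ 2) / (2 * T) + -a * z)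
      = (2 * T * a + z) ^ 2 / (4 * T) := by
    field_simp
    ring
  have h2 : 0 ≤ (2 * T * a + z) ^ 2 / (4 * T) := by positivity
  linarith

lemma robin_integral_le (a T t s : ℝ) (ht : 0 < t) (htT : t ≤ T) (hs : 0 ≤ s) :
    (∫ z in Set.Ioi (0 : ℝ), heatKernel t (s + z) * Real.exp (-a * z)) ≤
      heatKernel t s *
        ∫ z in Set.Ioi (0 : ℝ), Real.exp (-(z ^ 2) / (2 * T)) * Real.exp (-a * z) := by
  have hT : 0 < T := lt_of_lt_of_le ht htT
  rw [← integral_const_mul]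
  refine integral_mono_of_nonneg
    (Filter.Eventually.of_forall fun z => mul_nonneg (heatKernel_nonneg _ _) (Real.exp_nonneg _))
    ((robin_integrable a T hT).integrableOn.const_mul _) ?_
  refine (ae_restrict_iff' measurableSet_Ioi).2 (Filter.Eventually.of_forall fun z hz => ?_)
  have hz : 0 < z := hz
  show heatKernel t (s + z) * Real.exp (-a * z) ≤
    heatKernel t s * (Real.exp (-(z ^ 2) / (2 * T)) * Real.exp (-a * z))
  rw [← mul_assoc]
  refine mul_le_mul_of_nonneg_right ?_ (Real.exp_nonneg _)
  unfold heatKernel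
  rw [mul_assoc _ (Real.exp (-(s ^ 2) / (2 * t))), ← Real.exp_add]
  refine mul_le_mul_of_nonneg_left (Real.exp_le_exp.2 ?_) (by positivity)
  have h1 : z ^ 2 / (2 * T) ≤ z ^ 2 / (2 * t) := by gcongr
  have h2 : -((s + z) ^ 2) / (2 * t) = -(s ^ 2) / (2 * t) - z ^ 2 / (2 * t) - s * z / t := by
    field_simp
    ring
  have h3 : 0 ≤ s * z / t := by positivity
  have h4 : -(z ^ 2) / (2 * T) = -(z ^ 2 / (2 * T)) := by ring
  rw [h2, h4]
  linarith

lemma robin_J_lt (a T : ℝ) (hT : 0 < T) (ha : 0 < a) :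
    a * (∫ z in Set.Ioi (0 : ℝ), Real.exp (-(z ^ 2) / (2 * T)) * Real.exp (-a * z)) < 1 := by
  have hi1 := (robin_integrable a T hT).integrableOn (s := Set.Ioi 0)
  have hi2 : IntegrableOn (fun z : ℝ => Real.exp (-a * z)) (Set.Ioi 0) :=
    integrableOn_exp_mul_Ioi (by linarith) 0
  have hv : (∫ z in Set.Ioi (0 : ℝ), Real.exp (-a * z)) = 1 / a := by
    rw [integral_exp_mul_Ioi (by linarith)]
    simp
  have hlt : ∀ z ∈ Set.Ioi (0 : ℝ),
      0 < Real.exp (-a * z) - Real.exp (-(z ^ 2) / (2 * T)) * Real.exp (-a * z) := by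
    intro z hz
    have hz : 0 < z := hz
    have h1 : Real.exp (-(z ^ 2) / (2 * T)) < 1 := by
      rw [Real.exp_lt_one_iff, neg_div]
      have : 0 < z ^ 2 / (2 * T) := by positivity
      linarith
    have h2 := Real.exp_pos (-a * z)
    nlinarith
  have hpos : 0 < ∫ z in Set.Ioi (0 : ℝ),
      (Real.exp (-a * z) - Real.exp (-(z ^ 2) / (2 * T)) * Real.exp (-a * z)) := by
    rw [setIntegral_pos_iff_support_of_nonneg_ae
      ((ae_restrict_iff' measurableSet_Ioi).2
        (Filter.Eventually.of_forall fun z hz => (hlt z hz).le)) (hi2.sub hi1)]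
    refine lt_of_lt_of_le ?_ (measure_mono (s := Set.Ioi (0 : ℝ)) ?_)
    · simp
    · exact fun z hz => ⟨(hlt z hz).ne', hz⟩
  rw [integral_sub hi2 hi1, hv] at hpos
  have := mul_pos ha hpos
  rw [mul_sub, mul_one_div_cancel ha.ne'] at this
  linarith

/-- The Robin heat kernel is comparable to the Gaussian heat kernel, uniformly over
`x, y ≥ 0` and `t ∈ (0, T]`. -/
theorem robin_heat_kernel_comparison (α T : ℝ) (hT : 0 < T) :
    ∃ C : ℝ, 0 < C ∧ ∀ x y : ℝ, 0 ≤ x → 0 ≤ y → ∀ t : ℝ, 0 < t → t ≤ T →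
      C⁻¹ * heatKernel t (x - y) ≤ robinKernel α t x y ∧
      robinKernel α t x y ≤ C * heatKernel t (x - y) := by
  unfold robinKernel
  obtain ⟨a, ha⟩ : ∃ a, a = α - 1 / 2 := ⟨_, rfl⟩
  rw [← ha]
  obtain ⟨K, hK⟩ : ∃ K, K =
    ∫ z in Set.Ioi (0 : ℝ), Real.exp (-(z ^ 2) / (2 * T)) * Real.exp (-a * z) := ⟨_, rfl⟩
  have hK0 : 0 ≤ K := by
    rw [hK]; exact integral_nonneg fun z => by positivity
  have key : ∀ x y : ℝ, 0 ≤ x → 0 ≤ y → ∀ t : ℝ, 0 < t → t ≤ T →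
      0 ≤ heatKernel t (x + y) ∧ heatKernel t (x + y) ≤ heatKernel t (x - y) ∧
      0 ≤ (∫ z in Set.Ioi (0 : ℝ), heatKernel t (x + y + z) * Real.exp (-a * z)) ∧
      (∫ z in Set.Ioi (0 : ℝ), heatKernel t (x + y + z) * Real.exp (-a * z)) ≤
        heatKernel t (x + y) * K := by
    intro x y hx hy t ht htT
    refine ⟨heatKernel_nonneg _ _, ?_, integral_nonneg fun z =>
      mul_nonneg (heatKernel_nonneg _ _) (Real.exp_nonneg _), ?_⟩
    · unfold heatKernel
      refine mul_le_mul_of_nonneg_left (Real.exp_le_exp.2 ?_) (by positivity)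
      have : 0 ≤ x * y := mul_nonneg hx hy
      gcongr ?_ / _
      nlinarith
    · rw [hK]
      exact robin_integral_le a T t (x + y) ht htT (by positivity)
  rcases le_or_gt a 0 with h | h
  · have hb : 0 ≤ -a * K := mul_nonneg (by linarith) hK0
    refine ⟨2 + 2 * (-a * K), by linarith, fun x y hx hy t ht htT => ?_⟩
    obtain ⟨h1, h2, h3, h4⟩ := key x y hx hy t ht htT
    generalize (∫ z in Set.Ioi (0 : ℝ), heatKernel t (x + y + z) * Real.exp (-a * z)) = I at *
    generalize heatKernel t (x + y) = q at *
    generalize heatKernel t (x - y) = P at *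
    have h5 : 0 ≤ -a * I := mul_nonneg (by linarith) h3
    have h6 : -a * I ≤ -a * (q * K) := mul_le_mul_of_nonneg_left h4 (by linarith)
    have h7 : (-a * K) * q ≤ (-a * K) * P := mul_le_mul_of_nonneg_left h2 hb
    constructor
    · have : (2 + 2 * (-a * K))⁻¹ * P ≤ 1 * P :=
        mul_le_mul_of_nonneg_right (inv_le_one_of_one_le₀ (by linarith)) (by linarith)
      linarith
    · linarith
  · have hJ := robin_J_lt a T hT h
    rw [← hK] at hJ
    have hJ0 : 0 ≤ a * K := mul_nonneg h.le hK0
    have hd : 0 < 1 - a * K := by linarith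
    refine ⟨2 * (1 - a * K)⁻¹, by positivity, fun x y hx hy t ht htT => ?_⟩
    obtain ⟨h1, h2, h3, h4⟩ := key x y hx hy t ht htT
    generalize (∫ z in Set.Ioi (0 : ℝ), heatKernel t (x + y + z) * Real.exp (-a * z)) = I at *
    generalize heatKernel t (x + y) = q at *
    generalize heatKernel t (x - y) = P at *
    have h5 : 0 ≤ a * I := mul_nonneg h.le h3
    have h6 : a * I ≤ a * (q * K) := mul_le_mul_of_nonneg_left h4 h.le
    have hP : 0 ≤ P := h1.trans h2
    constructor
    · rw [mul_inv, inv_inv]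
      have e1 : 0 ≤ (a * K) * (P - q) := mul_nonneg hJ0 (by linarith)
      have e2 : 0 ≤ (1 - a * K) * q := mul_nonneg hd.le h1
      have e3 : 0 ≤ (1 - a * K) * P := mul_nonneg hd.le hP
      linarith
    · have h7 : 1 ≤ (1 - a * K)⁻¹ := (one_le_inv₀ hd).2 (by linarith)
      have h8 : 1 * P ≤ (1 - a * K)⁻¹ * P := mul_le_mul_of_nonneg_right h7 hP
      linarith
end

section
/- Fix α ∈ ℝ and T > 0. For all t ∈ (0, T] and all x, y ≥ 0 with x + y ≥ (|α| + 4) · T, the quantity x + y + (α − 1/2)t is positive and one has 0 ≤ ∫₀^∞ 𝔭_t(x+y+z) · exp(−(α−1/2)z) dz ≤ t · 𝔭_t(x+y) / (x + y + (α−1/2)t). -/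
open MeasureTheory

/-- The key integral estimate comparing the Robin heat kernel with the Gaussian heat
kernel: for `t ∈ (0,T]` and `x, y ≥ 0` with `x + y ≥ (|α| + 4)T`, the quantity
`x + y + (α − 1/2)t` is positive and
`0 ≤ ∫₀^∞ 𝔭_t(x+y+z) e^{−(α−1/2)z} dz ≤ t 𝔭_t(x+y) / (x + y + (α−1/2)t)`. -/
theorem robin_integral_estimate (α T : ℝ) (hT : 0 < T) (t : ℝ) (ht0 : 0 < t) (htT : t ≤ T)
    (x y : ℝ) (hx : 0 ≤ x) (hy : 0 ≤ y) (hxy : (|α| + 4) * T ≤ x + y) :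
    0 < x + y + (α - 1 / 2) * t ∧
    0 ≤ ∫ z in Set.Ioi (0 : ℝ), heatKernel t (x + y + z) * Real.exp (-(α - 1 / 2) * z) ∧
    (∫ z in Set.Ioi (0 : ℝ), heatKernel t (x + y + z) * Real.exp (-(α - 1 / 2) * z))
      ≤ t * heatKernel t (x + y) / (x + y + (α - 1 / 2) * t) := by
  have hpos : 0 < x + y + (α - 1 / 2) * t := by
    have h1 : -(|α| * t) ≤ α * t := by
      have := mul_le_mul_of_nonneg_right (neg_abs_le α) ht0.le
      linarith
    have h2 : |α| * t ≤ |α| * T := mul_le_mul_of_nonneg_left htT (abs_nonneg α)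
    nlinarith
  have hnn : ∀ z : ℝ, 0 ≤ heatKernel t (x + y + z) * Real.exp (-(α - 1 / 2) * z) := by
    intro z
    unfold heatKernel
    positivity
  refine ⟨hpos, integral_nonneg hnn, ?_⟩
  have ha : -((x + y + (α - 1 / 2) * t) / t) < 0 := neg_lt_zero.mpr (div_pos hpos ht0)
  have hint := (integrableOn_exp_mul_Ioi ha 0).const_mul (heatKernel t (x + y))
  have hval := integral_exp_mul_Ioi ha 0
  have hle : (∫ z in Set.Ioi (0 : ℝ), heatKernel t (x + y + z) * Real.exp (-(α - 1 / 2) * z))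
      ≤ ∫ z in Set.Ioi (0 : ℝ), heatKernel t (x + y) *
        Real.exp (-((x + y + (α - 1 / 2) * t) / t) * z) := by
    refine integral_mono_of_nonneg (Filter.Eventually.of_forall hnn) hint
      (Filter.Eventually.of_forall fun z => ?_)
    simp only [heatKernel]
    rw [mul_assoc (_)⁻¹, mul_assoc (_)⁻¹, ← Real.exp_add, ← Real.exp_add]
    refine mul_le_mul_of_nonneg_left (Real.exp_le_exp.mpr ?_) (by positivity)
    have h : -(x + y) ^ 2 / (2 * t) + -((x + y + (α - 1 / 2) * t) / t) * z
        - (-(x + y + z) ^ 2 / (2 * t) + -(α - 1 / 2) * z) = z ^ 2 / (2 * t) := by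
      field_simp
      ring
    have h' : 0 ≤ z ^ 2 / (2 * t) := by positivity
    linarith
  refine hle.trans (le_of_eq ?_)
  rw [integral_const_mul, hval, mul_zero, Real.exp_zero]
  have hne := hpos.ne'
  generalize x + y + (α - 1 / 2) * t = d at hne ⊢
  field_simp
end

section
/- Fix an integer A < 0, reals L > 0 and N ≥ 1, and β ≥ 0. Let a₁ ≥ a₂ be integers with a₁ − a₂ even, and for i = 1, 2 let μ_i be the probability measure on Ω_{a_i} with μ_i({ℓ}) proportional to W_β(ℓ). Then there exists a coupling ν of μ₁ and μ₂ supported on the set of pairs (ℓ₁, ℓ₂) satisfying ℓ₁(k) ≥ ℓ₂(k) ≥ ℓ₁(k) − (a₁ − a₂) for every k ∈ {A, A+1, …, 0}. -/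
/-- `ℓ : ℤ → ℤ` encodes a path on `{A, A+1, …, 0}` started at `a`: it equals `a` at
(and to the left of) `A`, makes `±1` steps on `{A,…,0}`, and is constant to the right
of `0` (the values outside `{A,…,0}` are irrelevant and normalized so that the set of
such paths is finite). -/
def IsPath (A a : ℤ) (ℓ : ℤ → ℤ) : Prop :=
  ℓ A = a ∧
  (∀ k : ℤ, A ≤ k → k < 0 → (ℓ (k + 1) - ℓ k = 1 ∨ ℓ (k + 1) - ℓ k = -1)) ∧
  (∀ k : ℤ, k ≤ A → ℓ k = a) ∧
  (∀ k : ℤ, 0 ≤ k → ℓ k = ℓ 0)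

/-- The weight `W_β(ℓ) = exp(−β ℓ(0)/√N − (L/N) ∑_{k=A}^{−1} exp(−√L ℓ(k)/√N))`. -/
noncomputable def pathWeight (N L β : ℝ) (A : ℤ) (ℓ : ℤ → ℤ) : ℝ :=
  Real.exp (-β * (ℓ 0 : ℝ) / Real.sqrt N -
    (L / N) * ∑ k ∈ Finset.Icc A (-1), Real.exp (-Real.sqrt L * (ℓ k : ℝ) / Real.sqrt N))

/-- Partition functions of paths with `n` steps left, started at `x`. -/
noncomputable def partFn (g V : ℤ → ℝ) : ℕ → ℤ → ℝ
  | 0, x => Real.exp (g x)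
  | n + 1, x => Real.exp (-V x) * (partFn g V n (x + 1) + partFn g V n (x - 1))

lemma partFn_pos (g V : ℤ → ℝ) (n : ℕ) (x : ℤ) : 0 < partFn g V n x := by
  induction n generalizing x with
  | zero => exact Real.exp_pos _
  | succ n ih =>
    have h1 := ih (x + 1)
    have h2 := ih (x - 1)
    simp only [partFn]
    positivity

lemma logconc_step (h : ℤ → ℝ) (hpos : ∀ x, 0 < h x)
    (hlc : ∀ x, h x * h (x + 4) ≤ h (x + 2) ^ 2) (x : ℤ) (m : ℕ) :
    h (x + 2 + 2 * m) * h x ≤ h (x + 2 * m) * h (x + 2) := by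
  induction m with
  | zero => simp [mul_comm]
  | succ m ih =>
    have e := hlc (x + 2 * m)
    rw [show x + 2 * (m : ℤ) + 4 = x + 2 + 2 * ((m + 1 : ℕ) : ℤ) by push_cast; ring,
      show x + 2 * (m : ℤ) + 2 = x + 2 * ((m + 1 : ℕ) : ℤ) by push_cast; ring] at e
    rw [show x + 2 + 2 * (m : ℤ) = x + 2 * ((m + 1 : ℕ) : ℤ) by push_cast; ring] at ih
    have p0 := hpos (x + 2 * m)
    have p1 := hpos (x + 2 * ((m + 1 : ℕ) : ℤ))
    have p2 := hpos x
    refine le_of_mul_le_mul_left ?_ p0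
    have s1 := mul_le_mul_of_nonneg_right e p2.le
    have s2 := mul_le_mul_of_nonneg_left ih p1.le
    nlinarith

lemma logconc_conv (b0 b1 b2 b3 : ℝ) (h0 : 0 < b0) (h1 : 0 < b1) (h2 : 0 < b2) (h3 : 0 < b3)
    (e1 : b0 * b2 ≤ b1 ^ 2) (e2 : b1 * b3 ≤ b2 ^ 2) :
    (b0 + b1) * (b2 + b3) ≤ (b1 + b2) ^ 2 := by
  have e3 : b0 * b3 ≤ b1 * b2 := by
    have h12 : 0 < b1 * b2 := by positivity
    refine le_of_mul_le_mul_left ?_ h12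
    have := mul_le_mul e1 e2 (by positivity) (by positivity)
    nlinarith
  nlinarith

lemma partFn_logconc (g V : ℤ → ℝ) (hg : ∀ x, g x + g (x + 4) ≤ 2 * g (x + 2))
    (hV : ∀ x, 2 * V (x + 2) ≤ V x + V (x + 4)) (n : ℕ) (x : ℤ) :
    partFn g V n x * partFn g V n (x + 4) ≤ partFn g V n (x + 2) ^ 2 := by
  induction n generalizing x with
  | zero =>
    simp only [partFn]
    rw [← Real.exp_add, ← Real.exp_nat_mul]
    exact Real.exp_le_exp.2 (by push_cast; exact hg x)
  | succ n ih =>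
    simp only [partFn]
    have c := logconc_conv _ _ _ _ (partFn_pos g V n (x - 1)) (partFn_pos g V n (x + 1))
      (partFn_pos g V n (x + 3)) (partFn_pos g V n (x + 5))
      (by have := ih (x - 1); ring_nf at this ⊢; exact this)
      (by have := ih (x + 1); ring_nf at this ⊢; exact this)
    have hE : Real.exp (-V x) * Real.exp (-V (x + 4)) ≤ Real.exp (-V (x + 2)) ^ 2 := by
      rw [← Real.exp_add, ← Real.exp_nat_mul]
      exact Real.exp_le_exp.2 (by push_cast; linarith [hV x])
    have := partFn_pos g V n (x - 1)
    have := partFn_pos g V n (x + 1)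
    have := partFn_pos g V n (x + 3)
    have := partFn_pos g V n (x + 5)
    rw [show x + 4 + 1 = x + 5 by ring, show x + 4 - 1 = x + 3 by ring,
      show x + 2 + 1 = x + 3 by ring, show x + 2 - 1 = x + 1 by ring]
    have := mul_le_mul hE c (by positivity) (by positivity)
    nlinarith

/-- Probability that the first step is up. -/
noncomputable def upProb (g V : ℤ → ℝ) (n : ℕ) (a : ℤ) : ℝ :=
  partFn g V n (a + 1) / (partFn g V n (a + 1) + partFn g V n (a - 1))

lemma upProb_nonneg (g V : ℤ → ℝ) (n : ℕ) (a : ℤ) : 0 ≤ upProb g V n a := by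
  have := partFn_pos g V n (a + 1)
  have := partFn_pos g V n (a - 1)
  unfold upProb
  positivity

lemma one_sub_upProb (g V : ℤ → ℝ) (n : ℕ) (a : ℤ) : 1 - upProb g V n a =
    partFn g V n (a - 1) / (partFn g V n (a + 1) + partFn g V n (a - 1)) := by
  have := partFn_pos g V n (a + 1)
  have := partFn_pos g V n (a - 1)
  unfold upProb
  field_simp
  ring

lemma upProb_le_one (g V : ℤ → ℝ) (n : ℕ) (a : ℤ) : upProb g V n a ≤ 1 := by
  have h := one_sub_upProb g V n a
  have := partFn_pos g V n (a + 1)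
  have := partFn_pos g V n (a - 1)
  have : 0 ≤ 1 - upProb g V n a := by rw [h]; positivity
  linarith

lemma upProb_anti (g V : ℤ → ℝ) (hg : ∀ x, g x + g (x + 4) ≤ 2 * g (x + 2))
    (hV : ∀ x, 2 * V (x + 2) ≤ V x + V (x + 4)) (n : ℕ) (a b : ℤ) (hab : b ≤ a)
    (hev : Even (a - b)) : upProb g V n a ≤ upProb g V n b := by
  obtain ⟨r, hr⟩ := hev
  obtain ⟨m, rfl⟩ := Int.eq_ofNat_of_zero_le (show 0 ≤ r by omega)
  have key := logconc_step _ (partFn_pos g V n) (partFn_logconc g V hg hV n) (b - 1) m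
  rw [show b - 1 + 2 + 2 * (m : ℤ) = a + 1 by omega, show b - 1 + 2 * (m : ℤ) = a - 1 by omega,
    show b - 1 + 2 = b + 1 by ring] at key
  have := partFn_pos g V n (a + 1)
  have := partFn_pos g V n (a - 1)
  have := partFn_pos g V n (b + 1)
  have := partFn_pos g V n (b - 1)
  unfold upProb
  rw [div_le_div_iff₀ (by positivity) (by positivity)]
  nlinarith

/-- Bernoulli law on `Bool`. -/
noncomputable def bern (p : ℝ) (h0 : 0 ≤ p) (h1 : p ≤ 1) : PMF Bool :=
  PMF.ofFintype (fun b => cond b (ENNReal.ofReal p) (ENNReal.ofReal (1 - p))) (by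
    simp only [Fintype.sum_bool, cond_true, cond_false]
    rw [← ENNReal.ofReal_add h0 (by linarith)]; simp)

lemma bern_coupling (p q : ℝ) (hp0 : 0 ≤ p) (hpq : p ≤ q) (hq1 : q ≤ 1) :
    ∃ J : PMF (Bool × Bool), J.map Prod.fst = bern p hp0 (hpq.trans hq1) ∧
      J.map Prod.snd = bern q (hp0.trans hpq) hq1 ∧
      ∀ s ∈ J.support, s.1 = true → s.2 = true := by
  have hs : ENNReal.ofReal p + ENNReal.ofReal (q - p) = ENNReal.ofReal q := by
    rw [← ENNReal.ofReal_add hp0 (by linarith)]; congr 1; ring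
  have hs' : ENNReal.ofReal (q - p) + ENNReal.ofReal (1 - q) = ENNReal.ofReal (1 - p) := by
    rw [← ENNReal.ofReal_add (by linarith) (by linarith)]; congr 1; ring
  refine ⟨PMF.ofFintype (fun s : Bool × Bool => cond s.1 (cond s.2 (ENNReal.ofReal p) 0)
    (cond s.2 (ENNReal.ofReal (q - p)) (ENNReal.ofReal (1 - q)))) ?_, ?_, ?_, ?_⟩
  · simp only [Fintype.sum_prod_type, Fintype.sum_bool, cond_true, cond_false, add_zero]
    rw [hs', ← ENNReal.ofReal_add hp0 (by linarith)]; simp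
  · ext b
    rw [PMF.map_apply, tsum_fintype]
    cases b <;> simp [Fintype.sum_prod_type, bern, hs']
  · ext b
    rw [PMF.map_apply, tsum_fintype]
    cases b <;> simp [Fintype.sum_prod_type, bern, hs]
  · rintro ⟨s, t⟩
    cases s <;> cases t <;> simp

/-- Target of a step. -/
def stepTo (a : ℤ) (s : Bool) : ℤ := cond s (a + 1) (a - 1)

/-- Prepend the value `a` at times at most `-(n+1)`. -/
def extPath (n : ℕ) (a : ℤ) (ℓ : ℤ → ℤ) : ℤ → ℤ := fun k => if k ≤ -((n : ℤ) + 1) then a else ℓ k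

/-- Law of the path. -/
noncomputable def pathLaw (g V : ℤ → ℝ) : ℕ → ℤ → PMF (ℤ → ℤ)
  | 0, a => PMF.pure (fun _ => a)
  | n + 1, a => (bern (upProb g V n a) (upProb_nonneg g V n a) (upProb_le_one g V n a)).bind
      (fun s => (pathLaw g V n (stepTo a s)).map (extPath n a))

lemma pathLaw_coupling (g V : ℤ → ℝ) (hg : ∀ x, g x + g (x + 4) ≤ 2 * g (x + 2))
    (hV : ∀ x, 2 * V (x + 2) ≤ V x + V (x + 4)) (n : ℕ) : ∀ a b : ℤ,
    ∃ Q : PMF ((ℤ → ℤ) × (ℤ → ℤ)), b ≤ a → Even (a - b) →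
      Q.map Prod.fst = pathLaw g V n a ∧ Q.map Prod.snd = pathLaw g V n b ∧
      ∀ p ∈ Q.support, ∀ k, p.2 k ≤ p.1 k ∧ p.1 k - (a - b) ≤ p.2 k := by
  induction n with
  | zero =>
    intro a b
    refine ⟨PMF.pure (fun _ => a, fun _ => b), fun hab _ => ⟨?_, ?_, ?_⟩⟩
    · simp [PMF.pure_map, pathLaw]
    · simp [PMF.pure_map, pathLaw]
    · intro p hp k
      rw [PMF.mem_support_pure_iff] at hp
      subst hp
      simp [hab]
  | succ n ih =>
    intro a b
    by_cases hc : b ≤ a ∧ Even (a - b)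
    swap
    · exact ⟨PMF.pure (fun _ => a, fun _ => b), fun h1 h2 => absurd ⟨h1, h2⟩ hc⟩
    obtain ⟨hab, hev⟩ := hc
    rcases eq_or_lt_of_le hab with rfl | hlt
    · refine ⟨(pathLaw g V (n + 1) b).map (fun x => (x, x)), fun _ _ => ⟨?_, ?_, ?_⟩⟩
      · rw [PMF.map_comp]; exact PMF.map_id _
      · rw [PMF.map_comp]; exact PMF.map_id _
      · intro p hp k
        rw [PMF.mem_support_map_iff] at hp
        obtain ⟨x, -, rfl⟩ := hp
        simp
    · choose Q hQ using ih
      obtain ⟨J, J1, J2, J3⟩ := bern_coupling (upProb g V n a) (upProb g V n b)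
        (upProb_nonneg g V n a) (upProb_anti g V hg hV n a b hab hev) (upProb_le_one g V n b)
      obtain ⟨r, hr⟩ := hev
      have hQ' : ∀ s ∈ J.support, stepTo b s.2 ≤ stepTo a s.1 ∧
          Even (stepTo a s.1 - stepTo b s.2) ∧
          stepTo a s.1 - stepTo b s.2 ≤ a - b := by
        rintro ⟨s, t⟩ hs
        have := J3 _ hs
        cases s <;> cases t <;> simp [stepTo] at this ⊢
        · exact ⟨by omega, ⟨r, by omega⟩⟩
        · exact ⟨by omega, ⟨r - 1, by omega⟩, by omega⟩
        · exact ⟨by omega, ⟨r, by omega⟩⟩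
      have bind_congr : ∀ (f f' : Bool × Bool → PMF (ℤ → ℤ)), (∀ s ∈ J.support, f s = f' s) →
          J.bind f = J.bind f' := by
        intro f f' hf
        ext y
        rw [PMF.bind_apply, PMF.bind_apply]
        refine tsum_congr fun s => ?_
        by_cases hs : s ∈ J.support
        · rw [hf s hs]
        · rw [(PMF.apply_eq_zero_iff _ _).2 hs]; simp
      refine ⟨J.bind (fun s => (Q (stepTo a s.1) (stepTo b s.2)).map
        (Prod.map (extPath n a) (extPath n b))), fun _ _ => ⟨?_, ?_, ?_⟩⟩
      · rw [PMF.map_bind]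
        simp only [pathLaw]
        rw [← J1, PMF.bind_map]
        refine bind_congr _ _ fun s hs => ?_
        obtain ⟨u1, u2, u3⟩ := hQ' s hs
        simp only [Function.comp]
        rw [← (hQ _ _ u1 u2).1, PMF.map_comp, PMF.map_comp]
        rfl
      · rw [PMF.map_bind]
        simp only [pathLaw]
        rw [← J2, PMF.bind_map]
        refine bind_congr _ _ fun s hs => ?_
        obtain ⟨u1, u2, u3⟩ := hQ' s hs
        simp only [Function.comp]
        rw [← (hQ _ _ u1 u2).2.1, PMF.map_comp, PMF.map_comp]
        rfl
      · intro p hp k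
        rw [PMF.mem_support_bind_iff] at hp
        obtain ⟨s, hs, hp⟩ := hp
        rw [PMF.mem_support_map_iff] at hp
        obtain ⟨⟨x, y⟩, hx, rfl⟩ := hp
        obtain ⟨u1, u2, u3⟩ := hQ' s hs
        have := (hQ _ _ u1 u2).2.2 _ hx k
        simp only [Prod.map, extPath] at this ⊢
        split_ifs <;> omega

/-- Path weight with general potentials. -/
noncomputable def genWeight (g V : ℤ → ℝ) (A : ℤ) (ℓ : ℤ → ℤ) : ℝ :=
  Real.exp (g (ℓ 0) - ∑ k ∈ Finset.Icc A (-1), V (ℓ k))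

lemma pathLaw_support (g V : ℤ → ℝ) (n : ℕ) (a : ℤ) (ℓ : ℤ → ℤ)
    (h : ℓ ∈ (pathLaw g V n a).support) : IsPath (-(n : ℤ)) a ℓ := by
  induction n generalizing a ℓ with
  | zero =>
    simp only [pathLaw, PMF.mem_support_pure_iff] at h
    subst h
    refine ⟨rfl, ?_, ?_, ?_⟩
    · intro k h1 h2; simp at h1; omega
    · simp
    · simp
  | succ n ih =>
    simp only [pathLaw] at h
    rw [PMF.mem_support_bind_iff] at h
    obtain ⟨s, -, h⟩ := h
    rw [PMF.mem_support_map_iff] at h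
    obtain ⟨x, hx, rfl⟩ := h
    obtain ⟨i1, i2, i3, i4⟩ := ih _ _ hx
    have hst : stepTo a s = a + 1 ∨ stepTo a s = a - 1 := by cases s <;> simp [stepTo]
    refine ⟨?_, ?_, ?_, ?_⟩
    · simp [extPath]
    · intro k h1 h2
      push_cast at h1
      simp only [extPath]
      rw [if_neg (by omega)]
      by_cases hk : k ≤ -((n : ℤ) + 1)
      · rw [if_pos hk, show k + 1 = -(n : ℤ) by omega, i1]
        omega
      · rw [if_neg hk]
        exact i2 k (by omega) h2
    · intro k hk
      push_cast at hk
      simp only [extPath]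
      rw [if_pos (by omega)]
    · intro k hk
      simp only [extPath]
      rw [if_neg (by omega), if_neg (by omega)]
      exact i4 k hk

lemma extPath_map_apply (g V : ℤ → ℝ) (n : ℕ) (a b : ℤ) (ℓ : ℤ → ℤ)
    (h : IsPath (-((n + 1 : ℕ) : ℤ)) a ℓ) :
    ((pathLaw g V n b).map (extPath n a)) ℓ =
      if ℓ (-(n : ℤ)) = b then
        (pathLaw g V n b) (fun k => if k ≤ -(n : ℤ) then b else ℓ k) else 0 := by
  obtain ⟨i1, i2, i3, i4⟩ := h
  push_cast at i1 i2 i3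
  split_ifs with hb
  · rw [PMF.map_apply, tsum_eq_single (fun k => if k ≤ -(n : ℤ) then b else ℓ k)]
    · rw [if_pos]
      funext k
      simp only [extPath]
      split_ifs with h1 h2
      · exact i3 k (by omega)
      · rw [show k = -(n : ℤ) by omega, hb]
      · rfl
    · intro x hx
      by_cases hs : x ∈ (pathLaw g V n b).support
      · obtain ⟨j1, j2, j3, j4⟩ := pathLaw_support g V n b x hs
        rw [if_neg]
        intro he
        apply hx
        funext k
        split_ifs with h1
        · exact j3 k h1
        · rw [he]
          simp only [extPath]
          rw [if_neg (by omega)]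
      · rw [(PMF.apply_eq_zero_iff _ _).2 hs]; simp
  · rw [PMF.apply_eq_zero_iff, PMF.mem_support_map_iff]
    rintro ⟨x, hx, rfl⟩
    obtain ⟨j1, j2, j3, j4⟩ := pathLaw_support g V n b x hx
    apply hb
    simp only [extPath]
    rw [if_neg (by omega), j1]

lemma pathLaw_apply (g V : ℤ → ℝ) (n : ℕ) (a : ℤ) (ℓ : ℤ → ℤ) (h : IsPath (-(n : ℤ)) a ℓ) :
    pathLaw g V n a ℓ = ENNReal.ofReal ((partFn g V n a)⁻¹ * genWeight g V (-(n : ℤ)) ℓ) := by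
  induction n generalizing a ℓ with
  | zero =>
    obtain ⟨i1, i2, i3, i4⟩ := h
    have : ℓ = fun _ => a := by
      funext k
      rcases le_total k 0 with hk | hk
      · exact i3 k (by simpa using hk)
      · rw [i4 k hk]; simpa using i1
    subst this
    simp [pathLaw, partFn, genWeight]
  | succ n ih =>
    have hp := h
    obtain ⟨i1, i2, i3, i4⟩ := h
    push_cast at i1 i2 i3
    simp only [pathLaw]
    rw [PMF.bind_apply, tsum_fintype, Fintype.sum_bool, extPath_map_apply g V n a _ ℓ hp,
      extPath_map_apply g V n a _ ℓ hp]
    have key : ∀ b, ℓ (-(n : ℤ)) = b →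
        IsPath (-(n : ℤ)) b (fun k => if k ≤ -(n : ℤ) then b else ℓ k) ∧
        genWeight g V (-((n + 1 : ℕ) : ℤ)) ℓ = Real.exp (-V a) *
          genWeight g V (-(n : ℤ)) (fun k => if k ≤ -(n : ℤ) then b else ℓ k) := by
      intro b hb
      have hf : ∀ k, -(n : ℤ) ≤ k → (if k ≤ -(n : ℤ) then b else ℓ k) = ℓ k := by
        intro k hk
        split_ifs with h1
        · rw [← hb, show k = -(n : ℤ) by omega]
        · rfl
      refine ⟨⟨?_, ?_, ?_, ?_⟩, ?_⟩
      · simp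
      · intro k h1 h2
        simp only []
        rw [hf k h1, hf (k + 1) (by omega)]
        exact i2 k (by omega) h2
      · intro k hk
        simp only []
        rw [if_pos hk]
      · intro k hk
        simp only []
        rw [hf k (by omega), hf 0 (by omega), i4 k hk]
      · unfold genWeight
        rw [← Real.exp_add]
        congr 1
        simp only []
        rw [hf 0 (by omega)]
        have e : Finset.Icc (-((n + 1 : ℕ) : ℤ)) (-1) =
            insert (-((n : ℤ) + 1)) (Finset.Icc (-(n : ℤ)) (-1)) := by
          ext k
          simp only [Finset.mem_Icc, Finset.mem_insert]
          push_cast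
          omega
        rw [e, Finset.sum_insert (by simp), i1]
        have e2 : ∑ k ∈ Finset.Icc (-(n : ℤ)) (-1), V (if k ≤ -(n : ℤ) then b else ℓ k) =
            ∑ k ∈ Finset.Icc (-(n : ℤ)) (-1), V (ℓ k) := by
          refine Finset.sum_congr rfl fun k hk => ?_
          rw [hf k (Finset.mem_Icc.1 hk).1]
        rw [e2]
        ring
    have q1 := partFn_pos g V n (a + 1)
    have q2 := partFn_pos g V n (a - 1)
    have hstep := i2 (-((n : ℤ) + 1)) (by omega) (by omega)
    rw [show -((n : ℤ) + 1) + 1 = -(n : ℤ) by ring, i1] at hstep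
    rcases hstep with hs | hs
    · have hb : ℓ (-(n : ℤ)) = a + 1 := by omega
      obtain ⟨k1, k2⟩ := key _ hb
      rw [k2, if_pos (by simpa [stepTo] using hb), if_neg (by simp only [stepTo, cond_false]; omega)]
      simp only [stepTo, cond_true, mul_zero, add_zero]
      rw [ih _ _ k1]
      simp only [bern, PMF.ofFintype_apply, cond_true]
      rw [← ENNReal.ofReal_mul (upProb_nonneg g V n a)]
      congr 1
      simp only [partFn, upProb]
      have := Real.exp_pos (-V a)
      field_simp
    · have hb : ℓ (-(n : ℤ)) = a - 1 := by omega
      obtain ⟨k1, k2⟩ := key _ hb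
      rw [k2, if_neg (by simp only [stepTo, cond_true]; omega), if_pos (by simpa [stepTo] using hb)]
      simp only [stepTo, cond_false, mul_zero, zero_add]
      rw [ih _ _ k1]
      simp only [bern, PMF.ofFintype_apply, cond_false]
      rw [← ENNReal.ofReal_mul (by linarith [upProb_le_one g V n a])]
      congr 1
      rw [one_sub_upProb]
      simp only [partFn]
      have := Real.exp_pos (-V a)
      field_simp

lemma eq_pathLaw (g V : ℤ → ℝ) (n : ℕ) (a : ℤ)
    (μ : PMF {ℓ : ℤ → ℤ // IsPath (-(n : ℤ)) a ℓ})
    (h : ∃ c : ℝ, 0 < c ∧ ∀ ℓ, μ ℓ = ENNReal.ofReal (c * genWeight g V (-(n : ℤ)) ℓ.val)) :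
    μ.map Subtype.val = pathLaw g V n a := by
  obtain ⟨c, hc, hμ⟩ := h
  have hZ := partFn_pos g V n a
  have hval : ∀ ℓ, (μ.map Subtype.val) ℓ =
      ENNReal.ofReal (c * partFn g V n a) * pathLaw g V n a ℓ := by
    intro ℓ
    by_cases hp : IsPath (-(n : ℤ)) a ℓ
    · rw [pathLaw_apply g V n a ℓ hp, PMF.map_apply, tsum_eq_single ⟨ℓ, hp⟩, if_pos rfl, hμ,
        ← ENNReal.ofReal_mul (by positivity)]
      · congr 1
        field_simp
      · rintro ⟨x, hx⟩ hne
        rw [if_neg]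
        rintro rfl
        exact hne rfl
    · rw [(PMF.apply_eq_zero_iff _ _).2 (fun hs => hp (pathLaw_support g V n a ℓ hs)), mul_zero,
        PMF.apply_eq_zero_iff, PMF.mem_support_map_iff]
      rintro ⟨x, -, rfl⟩
      exact hp x.2
  have hsum : ENNReal.ofReal (c * partFn g V n a) = 1 := by
    have h1 := (μ.map Subtype.val).tsum_coe
    rw [tsum_congr hval, ENNReal.tsum_mul_left, PMF.tsum_coe, mul_one] at h1
    exact h1
  ext ℓ
  rw [hval, hsum, one_mul]

/-- Discrete monotone coupling in the starting point: if `a₁ ≥ a₂` with `a₁ − a₂` even,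
and `μᵢ` is the probability measure on paths started at `aᵢ` proportional to `W_β`,
then there is a coupling `ν` of `μ₁` and `μ₂` supported on pairs `(ℓ₁, ℓ₂)` with
`ℓ₁(k) ≥ ℓ₂(k) ≥ ℓ₁(k) − (a₁ − a₂)` for all `k ∈ {A,…,0}`. -/
theorem monotone_coupling_startpoint (A : ℤ) (hA : A < 0) (L N : ℝ) (hL : 0 < L)
    (hN : 1 ≤ N) (β : ℝ) (hβ : 0 ≤ β) (a₁ a₂ : ℤ) (ha : a₂ ≤ a₁) (heven : Even (a₁ - a₂))
    (μ₁ : PMF {ℓ : ℤ → ℤ // IsPath A a₁ ℓ}) (μ₂ : PMF {ℓ : ℤ → ℤ // IsPath A a₂ ℓ})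
    (h₁ : ∃ c : ℝ, 0 < c ∧ ∀ ℓ, μ₁ ℓ = ENNReal.ofReal (c * pathWeight N L β A ℓ.val))
    (h₂ : ∃ c : ℝ, 0 < c ∧ ∀ ℓ, μ₂ ℓ = ENNReal.ofReal (c * pathWeight N L β A ℓ.val)) :
    ∃ ν : PMF ({ℓ : ℤ → ℤ // IsPath A a₁ ℓ} × {ℓ : ℤ → ℤ // IsPath A a₂ ℓ}),
      ν.map Prod.fst = μ₁ ∧ ν.map Prod.snd = μ₂ ∧
      ∀ p ∈ ν.support, ∀ k : ℤ, A ≤ k → k ≤ 0 →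
        p.2.val k ≤ p.1.val k ∧ p.1.val k - (a₁ - a₂) ≤ p.2.val k := by
  obtain ⟨n, hn⟩ := Int.eq_ofNat_of_zero_le (show 0 ≤ -A by omega)
  obtain rfl : A = -(n : ℤ) := by omega
  set g : ℤ → ℝ := fun x => -β * (x : ℝ) / Real.sqrt N with hgdef
  set V : ℤ → ℝ := fun x => (L / N) * Real.exp (-Real.sqrt L * (x : ℝ) / Real.sqrt N) with hVdef
  have hw : ∀ ℓ, pathWeight N L β (-(n : ℤ)) ℓ = genWeight g V (-(n : ℤ)) ℓ := by
    intro ℓ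
    simp only [pathWeight, genWeight, hgdef, hVdef, Finset.mul_sum]
  simp only [hw] at h₁ h₂
  have hg : ∀ x, g x + g (x + 4) ≤ 2 * g (x + 2) := by
    intro x
    simp only [hgdef]
    push_cast
    apply le_of_eq
    ring
  have hV : ∀ x, 2 * V (x + 2) ≤ V x + V (x + 4) := by
    intro x
    simp only [hVdef]
    push_cast
    set t := -Real.sqrt L / Real.sqrt N with ht
    have e1 : Real.exp (-Real.sqrt L * ((x : ℝ) + 2) / Real.sqrt N) =
        Real.exp (-Real.sqrt L * (x : ℝ) / Real.sqrt N) * Real.exp (2 * t) := by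
      rw [← Real.exp_add, ht]; congr 1; ring
    have e2 : Real.exp (-Real.sqrt L * ((x : ℝ) + 4) / Real.sqrt N) =
        Real.exp (-Real.sqrt L * (x : ℝ) / Real.sqrt N) * Real.exp (2 * t) ^ 2 := by
      rw [← Real.exp_nat_mul, ← Real.exp_add, ht]; congr 1; push_cast; ring
    rw [e1, e2]
    have hLN : 0 < L / N := by positivity
    have hE := Real.exp_pos (-Real.sqrt L * (x : ℝ) / Real.sqrt N)
    nlinarith [mul_nonneg (mul_pos hLN hE).le (sq_nonneg (Real.exp (2 * t) - 1))]
  have m1 := eq_pathLaw g V n a₁ μ₁ h₁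
  have m2 := eq_pathLaw g V n a₂ μ₂ h₂
  obtain ⟨Q, hQ⟩ := pathLaw_coupling g V hg hV n a₁ a₂
  obtain ⟨Q1, Q2, Q3⟩ := hQ ha heven
  rw [← m1] at Q1
  rw [← m2] at Q2
  obtain ⟨x₁, -⟩ := μ₁.support_nonempty
  obtain ⟨x₂, -⟩ := μ₂.support_nonempty
  classical
  let f₁ : (ℤ → ℤ) → {ℓ : ℤ → ℤ // IsPath (-(n : ℤ)) a₁ ℓ} :=
    fun ℓ => if h : IsPath (-(n : ℤ)) a₁ ℓ then ⟨ℓ, h⟩ else x₁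
  let f₂ : (ℤ → ℤ) → {ℓ : ℤ → ℤ // IsPath (-(n : ℤ)) a₂ ℓ} :=
    fun ℓ => if h : IsPath (-(n : ℤ)) a₂ ℓ then ⟨ℓ, h⟩ else x₂
  have hf₁ : f₁ ∘ Subtype.val = id := by
    funext y
    simp [f₁, y.2]
  have hf₂ : f₂ ∘ Subtype.val = id := by
    funext y
    simp [f₂, y.2]
  refine ⟨Q.map (Prod.map f₁ f₂), ?_, ?_, ?_⟩
  · rw [PMF.map_comp, show Prod.fst ∘ Prod.map f₁ f₂ = f₁ ∘ Prod.fst from rfl, ← PMF.map_comp,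
      Q1, PMF.map_comp, hf₁, PMF.map_id]
  · rw [PMF.map_comp, show Prod.snd ∘ Prod.map f₁ f₂ = f₂ ∘ Prod.snd from rfl, ← PMF.map_comp,
      Q2, PMF.map_comp, hf₂, PMF.map_id]
  · intro p hp k _ _
    rw [PMF.mem_support_map_iff] at hp
    obtain ⟨⟨y₁, y₂⟩, hy, rfl⟩ := hp
    have s1 : y₁ ∈ (Q.map Prod.fst).support := (PMF.mem_support_map_iff _ _ _).2 ⟨_, hy, rfl⟩
    have s2 : y₂ ∈ (Q.map Prod.snd).support := (PMF.mem_support_map_iff _ _ _).2 ⟨_, hy, rfl⟩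
    rw [Q1, PMF.mem_support_map_iff] at s1
    rw [Q2, PMF.mem_support_map_iff] at s2
    obtain ⟨z₁, -, rfl⟩ := s1
    obtain ⟨z₂, -, rfl⟩ := s2
    have := Q3 _ hy k
    have w1 : f₁ z₁.val = z₁ := congrFun hf₁ z₁
    have w2 : f₂ z₂.val = z₂ := congrFun hf₂ z₂
    simp only [Prod.map, w1, w2]
    exact this
end

section
/- Fix an integer A < 0, reals L > 0 and N ≥ 1, and an integer a. Let 0 ≤ β₁ ≤ β₂, and for i = 1, 2 let μ_{β_i} be the probability measure on Ω_a with μ_{β_i}({ℓ}) proportional to W_{β_i}(ℓ). Then there exists a coupling ν of μ_{β₁} and μ_{β₂} supported on the set of pairs (ℓ₁, ℓ₂) satisfying ℓ₁(k) ≥ ℓ₂(k) for every k ∈ {A, A+1, …, 0}. -/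
namespace MonoCoupling

/-- Probability of outcome `b` for success probability `p`. -/
noncomputable def bmass (p : ℝ) (b : Bool) : ℝ := cond b p (1 - p)

/-- Bernoulli law. -/
noncomputable def bern (p : Set.Icc (0:ℝ) 1) : PMF Bool :=
  PMF.ofFintype (fun b => ENNReal.ofReal (bmass p b)) (by
    have h0 := p.2.1
    have h1 := p.2.2
    simp only [Fintype.sum_bool, bmass, cond_true, cond_false]
    rw [← ENNReal.ofReal_add h0 (by linarith)]
    simp)

/-- Masses of the monotone coupling of two Bernoulli laws. -/
noncomputable def kmass (p q : ℝ) : Bool × Bool → ℝ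
  | (true, true) => min p q
  | (true, false) => p - min p q
  | (false, true) => q - min p q
  | (false, false) => 1 - max p q

lemma kmass_nonneg (p q : Set.Icc (0:ℝ) 1) (b : Bool × Bool) : 0 ≤ kmass p q b := by
  have h0 := p.2.1
  have h1 := p.2.2
  have h0' := q.2.1
  have h1' := q.2.2
  rcases b with ⟨_ | _, _ | _⟩ <;> simp [kmass, *]

noncomputable def kap (p q : Set.Icc (0:ℝ) 1) : PMF (Bool × Bool) :=
  PMF.ofFintype (fun b => ENNReal.ofReal (kmass p q b)) (by
    rw [← ENNReal.ofReal_sum_of_nonneg (fun b _ => kmass_nonneg p q b), Fintype.sum_prod_type]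
    simp only [Fintype.sum_bool, kmass]
    have := min_add_max (p:ℝ) q
    rw [← ENNReal.ofReal_one]
    congr 1
    linarith)

lemma kap_fst (p q : Set.Icc (0:ℝ) 1) : (kap p q).map Prod.fst = bern p := by
  ext b
  have := min_add_max (p:ℝ) q
  rw [PMF.map_apply, tsum_fintype, Fintype.sum_prod_type]
  simp only [Fintype.sum_bool, kap, bern, PMF.ofFintype_apply]
  rcases b with _ | _
  · simp only [Bool.false_eq_true, if_false, zero_add, if_true]
    rw [← ENNReal.ofReal_add (kmass_nonneg _ _ _) (kmass_nonneg _ _ _)]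
    congr 1
    simp only [kmass, bmass, cond_false]; linarith
  · simp only [Bool.true_eq_false, add_zero, reduceIte]
    rw [← ENNReal.ofReal_add (kmass_nonneg _ _ _) (kmass_nonneg _ _ _)]
    congr 1
    simp only [kmass, bmass, cond_true]; linarith

lemma kap_snd (p q : Set.Icc (0:ℝ) 1) : (kap p q).map Prod.snd = bern q := by
  ext b
  have := min_add_max (p:ℝ) q
  rw [PMF.map_apply, tsum_fintype, Fintype.sum_prod_type]
  simp only [Fintype.sum_bool, kap, bern, PMF.ofFintype_apply]
  rcases b with _ | _
  · simp only [Bool.false_eq_true, zero_add, reduceIte]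
    rw [← ENNReal.ofReal_add (kmass_nonneg _ _ _) (kmass_nonneg _ _ _)]
    congr 1
    simp only [kmass, bmass, cond_false]; linarith
  · simp only [Bool.true_eq_false, add_zero, reduceIte]
    rw [← ENNReal.ofReal_add (kmass_nonneg _ _ _) (kmass_nonneg _ _ _)]
    congr 1
    simp only [kmass, bmass, cond_true]; linarith

lemma kap_supp (p q : Set.Icc (0:ℝ) 1) (h : q ≤ p) : (false, true) ∉ (kap p q).support := by
  have h' : (q:ℝ) ≤ p := h
  simp [kap, kmass, h']

/-- The increment. -/
def sg (b : Bool) : ℤ := cond b 1 (-1)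

def ext (A : ℤ) (n : ℕ) (ℓ : ℤ → ℤ) (b : Bool) : ℤ → ℤ :=
  fun k => if k ≤ A + n then ℓ k else ℓ (A + n) + sg b

noncomputable def walk (A a : ℤ) (p : ℕ → ℤ → Set.Icc (0:ℝ) 1) : ℕ → PMF (ℤ → ℤ)
  | 0 => PMF.pure (fun _ => a)
  | n + 1 => (walk A a p n).bind fun ℓ => (bern (p n (ℓ (A + n)))).map (ext A n ℓ)

lemma coupling (A a : ℤ) (p q : ℕ → ℤ → Set.Icc (0:ℝ) 1) (h : ∀ n x, q n x ≤ p n x) (n : ℕ) :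
    ∃ Q : PMF ((ℤ → ℤ) × (ℤ → ℤ)), Q.map Prod.fst = walk A a p n ∧ Q.map Prod.snd = walk A a q n ∧
      ∀ r ∈ Q.support, ∀ k, r.2 k ≤ r.1 k ∧ Even (r.1 k - r.2 k) := by
  induction n with
  | zero =>
    refine ⟨PMF.pure (fun _ => a, fun _ => a), ?_, ?_, ?_⟩
    · rw [PMF.pure_map]; rfl
    · rw [PMF.pure_map]; rfl
    · intro r hr k
      rw [PMF.mem_support_pure_iff] at hr
      subst hr
      simp
  | succ n ih =>
    obtain ⟨Q, h1, h2, h3⟩ := ih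
    refine ⟨Q.bind fun r => (kap (p n (r.1 (A + n))) (q n (r.2 (A + n)))).map
      (fun b => (ext A n r.1 b.1, ext A n r.2 b.2)), ?_, ?_, ?_⟩
    · rw [PMF.map_bind, walk, ← h1, PMF.bind_map]
      congr 1
      funext r
      rw [PMF.map_comp, Function.comp_apply, ← kap_fst _ (q n (r.2 (A + n))), PMF.map_comp]
      rfl
    · rw [PMF.map_bind, walk, ← h2, PMF.bind_map]
      congr 1
      funext r
      rw [PMF.map_comp, Function.comp_apply, ← kap_snd (p n (r.1 (A + n))) _, PMF.map_comp]
      rfl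
    · intro r hr k
      rw [PMF.mem_support_bind_iff] at hr
      obtain ⟨s, hs, hr⟩ := hr
      rw [PMF.mem_support_map_iff] at hr
      obtain ⟨b, hb, rfl⟩ := hr
      have hk := h3 s hs k
      have hn := h3 s hs (A + n)
      simp only [ext]
      split_ifs with hc
      · exact hk
      · obtain ⟨hn1, t, ht⟩ := hn
        have hpq : s.1 (A + n) = s.2 (A + n) → b ≠ (false, true) := by
          rintro e rfl
          refine kap_supp _ _ ?_ hb
          rw [e]; exact h _ _
        rcases b with ⟨_ | _, _ | _⟩ <;> simp only [sg, cond_true, cond_false]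
        · exact ⟨by omega, t, by omega⟩
        · have : s.1 (A + n) ≠ s.2 (A + n) := fun e => hpq e rfl
          exact ⟨by omega, t - 1, by omega⟩
        · exact ⟨by omega, t + 1, by omega⟩
        · exact ⟨by omega, t, by omega⟩

def Good (A a : ℤ) (n : ℕ) (ℓ : ℤ → ℤ) : Prop :=
  (∀ k ≤ A, ℓ k = a) ∧
  (∀ j < n, ℓ (A + j + 1) - ℓ (A + j) = 1 ∨ ℓ (A + j + 1) - ℓ (A + j) = -1) ∧
  ∀ k, A + n ≤ k → ℓ k = ℓ (A + n)

lemma walk_supp (A a : ℤ) (p : ℕ → ℤ → Set.Icc (0:ℝ) 1) (n : ℕ) :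
    ∀ ℓ ∈ (walk A a p n).support, Good A a n ℓ := by
  induction n with
  | zero =>
    intro ℓ h
    rw [walk, PMF.mem_support_pure_iff] at h
    subst h
    simp [Good]
  | succ n ih =>
    intro ℓ h
    rw [walk, PMF.mem_support_bind_iff] at h
    obtain ⟨s, hs, hr⟩ := h
    rw [PMF.mem_support_map_iff] at hr
    obtain ⟨b, hb, rfl⟩ := hr
    obtain ⟨g1, g2, g3⟩ := ih s hs
    refine ⟨?_, ?_, ?_⟩
    · intro k hk
      simp only [ext]
      rw [if_pos (by omega)]
      exact g1 k hk
    · intro j hj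
      simp only [ext]
      by_cases hjn : j < n
      · rw [if_pos (by omega), if_pos (by omega)]
        exact g2 j hjn
      · have : j = n := by omega
        subst this
        rw [if_neg (by omega), if_pos (by omega)]
        rcases b with _ | _ <;> simp [sg]
    · intro k hk
      simp only [ext]
      push_cast at hk ⊢
      rw [if_neg (by omega), if_neg (by omega)]

/-- direction of the `j`-th step -/
def up (A : ℤ) (ℓ : ℤ → ℤ) (j : ℕ) : Bool := decide (ℓ (A + j + 1) - ℓ (A + j) = 1)

lemma bern_map_apply (p : Set.Icc (0:ℝ) 1) (f : Bool → ℤ → ℤ) (hf : Function.Injective f) (b : Bool) :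
    (bern p).map f (f b) = ENNReal.ofReal (bmass p b) := by
  rw [PMF.map_apply, tsum_eq_single b]
  · simp [bern]
  · intro c hc
    rw [if_neg]
    intro h
    exact hc (hf h).symm

lemma ext_inj (A : ℤ) (n : ℕ) (ℓ : ℤ → ℤ) : Function.Injective (ext A n ℓ) := by
  intro b c h
  have := congrFun h (A + n + 1)
  simp only [ext] at this
  rw [if_neg (by omega), if_neg (by omega)] at this
  rcases b with _ | _ <;> rcases c with _ | _ <;> simp [sg] at this ⊢

lemma walk_apply (A a : ℤ) (p : ℕ → ℤ → Set.Icc (0:ℝ) 1) (n : ℕ) :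
    ∀ ℓ, Good A a n ℓ → walk A a p n ℓ =
      ENNReal.ofReal (∏ j ∈ Finset.range n, bmass (p j (ℓ (A + j))) (up A ℓ j)) := by
  induction n with
  | zero =>
    intro ℓ ⟨g1, g2, g3⟩
    have : ℓ = fun _ => a := by
      funext k
      rcases le_total k A with h | h
      · exact g1 k h
      · rw [g3 k (by simpa using h)]; exact g1 _ (by simp)
    subst this
    simp [walk]
  | succ n ih =>
    intro ℓ hg
    obtain ⟨g1, g2, g3⟩ := hg
    set s : ℤ → ℤ := fun k => if k ≤ A + n then ℓ k else ℓ (A + n) with hs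
    have sle : ∀ k ≤ A + n, s k = ℓ k := fun k hk => by simp [hs, hk]
    have sg' : Good A a n s := by
      refine ⟨?_, ?_, ?_⟩
      · intro k hk
        rw [sle k (by omega)]; exact g1 k hk
      · intro j hj
        rw [sle _ (by omega), sle _ (by omega)]; exact g2 j (by omega)
      · intro k hk
        simp only [hs]
        split_ifs with h1 h2 h2
        · rw [show k = A + n by omega]
        · omega
        · rfl
        · omega
    have hext : ext A n s (up A ℓ n) = ℓ := by
      funext k
      simp only [ext]
      split_ifs with hk
      · exact sle k hk
      · rw [sle _ le_rfl, g3 k (by push_cast; omega)]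
        have := g2 n (by omega)
        push_cast
        rw [← add_assoc]
        simp only [up, sg]
        rcases this with h | h
        · simp [h]; omega
        · simp [h]; omega
    rw [walk, PMF.bind_apply, tsum_eq_single s]
    · rw [ih s sg']
      conv_lhs => rw [← hext]
      rw [hext, ← hext, bern_map_apply _ _ (ext_inj A n s), hext, ← ENNReal.ofReal_mul, Finset.prod_range_succ]
      · congr 1
        rw [sle _ le_rfl]
        congr 1
        refine Finset.prod_congr rfl fun j hj => ?_
        have := Finset.mem_range.1 hj
        simp only [up]
        rw [sle _ (by omega), sle _ (by omega)]
      · refine Finset.prod_nonneg fun j _ => ?_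
        have h0 := (p j (s (A + j))).2.1
        have h1 := (p j (s (A + j))).2.2
        cases up A s j
        · exact sub_nonneg.2 h1
        · exact h0
    · intro t ht
      by_contra hne
      have ⟨h1, h2⟩ := mul_ne_zero_iff.1 hne
      have gt := walk_supp A a p n t ((PMF.mem_support_iff _ _).2 h1)
      obtain ⟨b, _, hb⟩ := (PMF.mem_support_map_iff _ _ _).1 ((PMF.mem_support_iff _ _).2 h2)
      apply ht
      funext k
      have e : ∀ k ≤ A + n, t k = ℓ k := by
        intro k hk
        rw [← hb]; simp [ext, hk]
      by_cases hk : k ≤ A + n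
      · rw [sle k hk, e k hk]
      · rw [gt.2.2 k (by omega), sg'.2.2 k (by omega), sle _ le_rfl, e _ le_rfl]

/-- Partition functions with `m` steps remaining. -/
noncomputable def Z (w z : ℤ → ℝ) : ℕ → ℤ → ℝ
  | 0, x => z x
  | m + 1, x => w x * (Z w z m (x + 1) + Z w z m (x - 1))

lemma Z_pos (w z : ℤ → ℝ) (hw : ∀ x, 0 < w x) (hz : ∀ x, 0 < z x) (m : ℕ) : ∀ x, 0 < Z w z m x := by
  induction m with
  | zero => exact hz
  | succ m ih => intro x; exact mul_pos (hw x) (add_pos (ih _) (ih _))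

lemma Z_ratio (w z z' : ℤ → ℝ) (hw : ∀ x, 0 < w x) (hz : ∀ x, 0 < z x) (hz' : ∀ x, 0 < z' x)
    (h : ∀ x, z' (x + 1) * z (x - 1) ≤ z (x + 1) * z' (x - 1)) (m : ℕ) :
    ∀ x, Z w z' m (x + 1) * Z w z m (x - 1) ≤ Z w z m (x + 1) * Z w z' m (x - 1) := by
  induction m with
  | zero => exact h
  | succ m ih =>
    intro x
    simp only [Z]
    have i1 := ih (x + 1)
    have i2 := ih (x - 1)
    rw [add_sub_cancel_right] at i1
    rw [sub_add_cancel] at i2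
    rw [add_sub_cancel_right, sub_add_cancel]
    have pa := Z_pos w z hw hz m (x + 1 + 1)
    have pb := Z_pos w z hw hz m x
    have pc := Z_pos w z hw hz m (x - 1 - 1)
    have pa' := Z_pos w z' hw hz' m (x + 1 + 1)
    have pb' := Z_pos w z' hw hz' m x
    have pc' := Z_pos w z' hw hz' m (x - 1 - 1)
    generalize Z w z m (x + 1 + 1) = a at *
    generalize Z w z m x = b at *
    generalize Z w z m (x - 1 - 1) = c at *
    generalize Z w z' m (x + 1 + 1) = a' at *
    generalize Z w z' m x = b' at *
    generalize Z w z' m (x - 1 - 1) = c' at *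
    have i3 : a' * c ≤ a * c' := by
      have : (a' * c) * (b * b') ≤ (a * c') * (b * b') := by
        calc (a' * c) * (b * b') = (a' * b) * (b' * c) := by ring
          _ ≤ (a * b') * (b * c') := by gcongr
          _ = _ := by ring
      exact le_of_mul_le_mul_right this (by positivity)
    have hww := mul_pos (hw (x + 1)) (hw (x - 1))
    have : (a' + b') * (b + c) ≤ (a + b) * (b' + c') := by nlinarith
    calc _ = (w (x + 1) * w (x - 1)) * ((a' + b') * (b + c)) := by ring
      _ ≤ (w (x + 1) * w (x - 1)) * ((a + b) * (b' + c')) := by gcongr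
      _ = _ := by ring

/-- Transition probabilities. -/
noncomputable def pr (w z : ℤ → ℝ) (hw : ∀ x, 0 < w x) (hz : ∀ x, 0 < z x) (T : ℕ) (n : ℕ) (x : ℤ) :
    Set.Icc (0:ℝ) 1 :=
  ⟨Z w z (T - n - 1) (x + 1) / (Z w z (T - n - 1) (x + 1) + Z w z (T - n - 1) (x - 1)), by
    have h1 := Z_pos w z hw hz (T - n - 1) (x + 1)
    have h2 := Z_pos w z hw hz (T - n - 1) (x - 1)
    refine ⟨by positivity, ?_⟩
    rw [div_le_one (by positivity)]; linarith⟩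

lemma pr_mono (w z z' : ℤ → ℝ) (hw : ∀ x, 0 < w x) (hz : ∀ x, 0 < z x) (hz' : ∀ x, 0 < z' x)
    (h : ∀ x, z' (x + 1) * z (x - 1) ≤ z (x + 1) * z' (x - 1)) (T n : ℕ) (x : ℤ) :
    pr w z' hw hz' T n x ≤ pr w z hw hz T n x := by
  have h1 := Z_pos w z hw hz (T - n - 1) (x + 1)
  have h2 := Z_pos w z hw hz (T - n - 1) (x - 1)
  have h3 := Z_pos w z' hw hz' (T - n - 1) (x + 1)
  have h4 := Z_pos w z' hw hz' (T - n - 1) (x - 1)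
  have := Z_ratio w z z' hw hz hz' h (T - n - 1) x
  refine Subtype.mk_le_mk.2 ?_
  rw [div_le_div_iff₀ (by positivity) (by positivity)]
  nlinarith

lemma pr_prod (A a : ℤ) (w z : ℤ → ℝ) (hw : ∀ x, 0 < w x) (hz : ∀ x, 0 < z x) (T : ℕ)
    (ℓ : ℤ → ℤ) (hℓ : Good A a T ℓ) (n : ℕ) (hn : n ≤ T) :
    (∏ j ∈ Finset.range n, bmass (pr w z hw hz T j (ℓ (A + j))) (up A ℓ j)) =
      (∏ j ∈ Finset.range n, w (ℓ (A + j))) * Z w z (T - n) (ℓ (A + n)) / Z w z T a := by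
  induction n with
  | zero =>
    have := (Z_pos w z hw hz T a).ne'
    simp [hℓ.1 A le_rfl, this]
  | succ n ih =>
    rw [Finset.prod_range_succ, Finset.prod_range_succ, ih (by omega)]
    obtain ⟨m, hm⟩ : ∃ m, T = n + 1 + m := ⟨T - (n + 1), by omega⟩
    have e1 : T - n = m + 1 := by omega
    have e2 : T - (n + 1) = m := by omega
    have e3 : T - n - 1 = m := by omega
    have hst := hℓ.2.1 n (by omega)
    have e4 : A + ((n + 1 : ℕ) : ℤ) = A + n + 1 := by push_cast; ring
    simp only [pr, e3]
    simp only [e1, e2, e4, Z]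
    have h1 := Z_pos w z hw hz m (ℓ (A + n) + 1)
    have h2 := Z_pos w z hw hz m (ℓ (A + n) - 1)
    have h3 := Z_pos w z hw hz T a
    have h4 := h1.ne'
    rcases hst with h | h
    · have hu : up A ℓ n = true := by simp [up, h]
      rw [hu, show ℓ (A + n + 1) = ℓ (A + n) + 1 by omega]
      simp only [bmass, cond_true]
      field_simp
    · have hu : up A ℓ n = false := by simp [up, h]
      rw [hu, show ℓ (A + n + 1) = ℓ (A + n) - 1 by omega]
      simp only [bmass, cond_false]
      field_simp
      ring

lemma good_iff (A a : ℤ) (hA : A < 0) (ℓ : ℤ → ℤ) : Good A a (-A).toNat ℓ ↔ IsPath A a ℓ := by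
  have hT : (((-A).toNat : ℕ) : ℤ) = -A := Int.toNat_of_nonneg (by omega)
  have hT' : A + (((-A).toNat : ℕ) : ℤ) = 0 := by omega
  unfold Good IsPath
  rw [hT']
  constructor
  · rintro ⟨g1, g2, g3⟩
    refine ⟨g1 A le_rfl, ?_, g1, g3⟩
    intro k hk hk0
    have := g2 (k - A).toNat (by omega)
    rwa [show A + (((k - A).toNat : ℕ) : ℤ) = k by omega] at this
  · rintro ⟨_, g2, g1, g3⟩
    exact ⟨g1, fun j hj => g2 _ (by omega) (by omega), g3⟩

/-- The Markov chain has the law given by the weights. -/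
lemma law (A : ℤ) (hA : A < 0) (a : ℤ) (w z : ℤ → ℝ) (hw : ∀ x, 0 < w x) (hz : ∀ x, 0 < z x)
    (μ : PMF {ℓ : ℤ → ℤ // IsPath A a ℓ}) (c : ℝ) (hc : 0 < c)
    (h : ∀ ℓ, μ ℓ = ENNReal.ofReal
      (c * ((∏ j ∈ Finset.range (-A).toNat, w (ℓ.val (A + j))) * z (ℓ.val 0)))) :
    walk A a (pr w z hw hz (-A).toNat) (-A).toNat = μ.map Subtype.val := by
  set T := (-A).toNat with hTdef
  have hT : A + (T : ℤ) = 0 := by omega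
  set P := walk A a (pr w z hw hz T) T with hP
  have hZ := Z_pos w z hw hz T a
  have key : ∀ ℓ : {ℓ : ℤ → ℤ // IsPath A a ℓ},
      μ ℓ = ENNReal.ofReal (c * Z w z T a) * P ℓ.val := by
    intro ℓ
    have g := (good_iff A a hA ℓ.val).2 ℓ.2
    rw [h, hP, walk_apply A a _ T ℓ.val g, pr_prod A a w z hw hz T ℓ.val g T le_rfl,
      ← ENNReal.ofReal_mul (by positivity), hT, Nat.sub_self]
    congr 1
    simp only [Z]
    field_simp
  have hmap : ∀ ℓ, μ.map Subtype.val ℓ = ENNReal.ofReal (c * Z w z T a) * P ℓ := by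
    intro ℓ
    by_cases hp : IsPath A a ℓ
    · rw [PMF.map_apply, tsum_eq_single ⟨ℓ, hp⟩]
      · rw [if_pos rfl, key]
      · intro t ht
        rw [if_neg]
        rintro rfl
        exact ht rfl
    · have h0 : P ℓ = 0 := by
        by_contra hne
        exact hp ((good_iff A a hA ℓ).1 (walk_supp A a _ T ℓ ((PMF.mem_support_iff _ _).2 hne)))
      rw [h0, mul_zero, PMF.map_apply]
      refine ENNReal.tsum_eq_zero.2 fun t => ?_
      rw [if_neg]
      rintro rfl
      exact hp t.2
  have hsum : ENNReal.ofReal (c * Z w z T a) = 1 := by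
    have h1 := (μ.map Subtype.val).tsum_coe
    simp_rw [hmap] at h1
    rwa [ENNReal.tsum_mul_left, P.tsum_coe, mul_one] at h1
  ext ℓ
  rw [hmap, hsum, one_mul]

lemma weight_eq (N L β : ℝ) (A : ℤ) (hA : A < 0) (ℓ : ℤ → ℤ) :
    pathWeight N L β A ℓ =
      (∏ j ∈ Finset.range (-A).toNat,
        Real.exp (-(L / N) * Real.exp (-Real.sqrt L * (ℓ (A + j) : ℝ) / Real.sqrt N))) *
      Real.exp (-β * (ℓ 0 : ℝ) / Real.sqrt N) := by
  rw [← Real.exp_sum, ← Real.exp_add, pathWeight, ← Finset.mul_sum]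
  congr 1
  have : ∑ k ∈ Finset.Icc A (-1), Real.exp (-Real.sqrt L * (ℓ k : ℝ) / Real.sqrt N) =
      ∑ j ∈ Finset.range (-A).toNat,
        Real.exp (-Real.sqrt L * (ℓ (A + j) : ℝ) / Real.sqrt N) := by
    symm
    refine Finset.sum_bij' (fun j _ => A + (j : ℤ)) (fun k _ => (k - A).toNat) ?_ ?_ ?_ ?_ ?_
    · intro j hj
      have := Finset.mem_range.1 hj
      rw [Finset.mem_Icc]; omega
    · intro k hk
      have := Finset.mem_Icc.1 hk
      rw [Finset.mem_range]; omega
    · intro j hj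
      simp
    · intro k hk
      have := Finset.mem_Icc.1 hk
      show A + (((k - A).toNat : ℕ) : ℤ) = k
      omega
    · intro j hj
      rfl
  rw [this]
  ring

end MonoCoupling


/-- Discrete monotone coupling in the drift parameter: if `0 ≤ β₁ ≤ β₂` and `μ_{βᵢ}` is
the probability measure on paths started at `a` proportional to `W_{βᵢ}`, then there is
a coupling `ν` of `μ_{β₁}` and `μ_{β₂}` supported on pairs `(ℓ₁, ℓ₂)` with
`ℓ₁(k) ≥ ℓ₂(k)` for all `k ∈ {A,…,0}`. -/
theorem monotone_coupling_drift (A : ℤ) (hA : A < 0) (L N : ℝ) (hL : 0 < L)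
    (hN : 1 ≤ N) (a : ℤ) (β₁ β₂ : ℝ) (hβ₁ : 0 ≤ β₁) (hβ : β₁ ≤ β₂)
    (μ₁ μ₂ : PMF {ℓ : ℤ → ℤ // IsPath A a ℓ})
    (h₁ : ∃ c : ℝ, 0 < c ∧ ∀ ℓ, μ₁ ℓ = ENNReal.ofReal (c * pathWeight N L β₁ A ℓ.val))
    (h₂ : ∃ c : ℝ, 0 < c ∧ ∀ ℓ, μ₂ ℓ = ENNReal.ofReal (c * pathWeight N L β₂ A ℓ.val)) :
    ∃ ν : PMF ({ℓ : ℤ → ℤ // IsPath A a ℓ} × {ℓ : ℤ → ℤ // IsPath A a ℓ}),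
      ν.map Prod.fst = μ₁ ∧ ν.map Prod.snd = μ₂ ∧
      ∀ p ∈ ν.support, ∀ k : ℤ, A ≤ k → k ≤ 0 → p.2.val k ≤ p.1.val k := by
  obtain ⟨c₁, hc₁, h₁⟩ := h₁
  obtain ⟨c₂, hc₂, h₂⟩ := h₂
  set w : ℤ → ℝ := fun x => Real.exp (-(L / N) * Real.exp (-Real.sqrt L * (x : ℝ) / Real.sqrt N))
  set z₁ : ℤ → ℝ := fun x => Real.exp (-β₁ * (x : ℝ) / Real.sqrt N) with hz1
  set z₂ : ℤ → ℝ := fun x => Real.exp (-β₂ * (x : ℝ) / Real.sqrt N) with hz2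
  have hw : ∀ x, 0 < w x := fun x => Real.exp_pos _
  have hz₁ : ∀ x, 0 < z₁ x := fun x => Real.exp_pos _
  have hz₂ : ∀ x, 0 < z₂ x := fun x => Real.exp_pos _
  have hN0 : 0 < Real.sqrt N := Real.sqrt_pos.2 (by linarith)
  have hzz : ∀ x, z₂ (x + 1) * z₁ (x - 1) ≤ z₁ (x + 1) * z₂ (x - 1) := by
    intro x
    simp only [hz1, hz2]
    rw [← Real.exp_add, ← Real.exp_add]
    apply Real.exp_le_exp.2
    rw [← add_div, ← add_div]
    refine div_le_div_of_nonneg_right ?_ hN0.le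
    push_cast
    nlinarith
  have l₁ := MonoCoupling.law A hA a w z₁ hw hz₁ μ₁ c₁ hc₁ (fun ℓ => by
    rw [h₁ ℓ, MonoCoupling.weight_eq N L β₁ A hA])
  have l₂ := MonoCoupling.law A hA a w z₂ hw hz₂ μ₂ c₂ hc₂ (fun ℓ => by
    rw [h₂ ℓ, MonoCoupling.weight_eq N L β₂ A hA])
  obtain ⟨Q, q1, q2, q3⟩ := MonoCoupling.coupling A a _ _
    (MonoCoupling.pr_mono w z₁ z₂ hw hz₁ hz₂ hzz (-A).toNat) (-A).toNat
  rw [l₁] at q1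
  rw [l₂] at q2
  classical
  obtain ⟨ℓ₀, _⟩ := μ₁.support_nonempty
  let f : (ℤ → ℤ) → {ℓ : ℤ → ℤ // IsPath A a ℓ} := fun ℓ =>
    if h : IsPath A a ℓ then ⟨ℓ, h⟩ else ℓ₀
  have hf : f ∘ Subtype.val = id := by
    funext ℓ
    simp [f, ℓ.2]
  refine ⟨Q.map (Prod.map f f), ?_, ?_, ?_⟩
  · have : (Prod.fst ∘ Prod.map f f) = f ∘ Prod.fst := rfl
    rw [PMF.map_comp, this, ← PMF.map_comp, q1, PMF.map_comp, hf, PMF.map_id]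
  · have : (Prod.snd ∘ Prod.map f f) = f ∘ Prod.snd := rfl
    rw [PMF.map_comp, this, ← PMF.map_comp, q2, PMF.map_comp, hf, PMF.map_id]
  · intro r hr k _ _
    obtain ⟨s, hs, rfl⟩ := (PMF.mem_support_map_iff _ _ _).1 hr
    have p1 : IsPath A a s.1 := by
      have : s.1 ∈ (Q.map Prod.fst).support := (PMF.mem_support_map_iff _ _ _).2 ⟨s, hs, rfl⟩
      rw [q1] at this
      obtain ⟨t, _, ht⟩ := (PMF.mem_support_map_iff _ _ _).1 this
      rw [← ht]; exact t.2
    have p2 : IsPath A a s.2 := by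
      have : s.2 ∈ (Q.map Prod.snd).support := (PMF.mem_support_map_iff _ _ _).2 ⟨s, hs, rfl⟩
      rw [q2] at this
      obtain ⟨t, _, ht⟩ := (PMF.mem_support_map_iff _ _ _).1 this
      rw [← ht]; exact t.2
    have := (q3 s hs k).1
    simpa [f, p1, p2] using this
end

section
/- Fix an integer A < 0, reals L > 0 and N ≥ 1, an integer a, β ≥ 0, and ε > 0. Let 0 ≤ κ₁ ≤ κ₂, and for i = 1, 2 let μ^{ε,κ_i} be the probability measure on Ω_a with μ^{ε,κ_i}({ℓ}) proportional to W^{ε,κ_i}(ℓ). Then there exists a coupling ν of μ^{ε,κ₁} and μ^{ε,κ₂} supported on the set of pairs (ℓ₁, ℓ₂) satisfying ℓ₁(k) ≥ ℓ₂(k) for every k ∈ {A, A+1, …, 0}. -/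
/-- The weight
`W^{ε,κ}(ℓ) = exp(−β max(ℓ(0)/√N + ε, 0) − (L/N) ∑_{k=A}^{−1} exp(−√L (ℓ(k)/√N + κ)))`. -/
noncomputable def pathWeightBarrier (N L β ε κ : ℝ) (A : ℤ) (ℓ : ℤ → ℤ) : ℝ :=
  Real.exp (-β * max ((ℓ 0 : ℝ) / Real.sqrt N + ε) 0 -
    (L / N) * ∑ k ∈ Finset.Icc A (-1),
      Real.exp (-Real.sqrt L * ((ℓ k : ℝ) / Real.sqrt N + κ)))


namespace BarrierCoupling

open scoped ENNReal

/-- Partition function with `n` remaining steps, started at `x`. -/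
noncomputable def Z (w : ℕ → ℤ → ℝ) : ℕ → ℤ → ℝ
  | 0, x => w 0 x
  | n + 1, x => w (n + 1) x * (Z w n (x + 1) + Z w n (x - 1))

/-- Weight of a trajectory with `n` remaining steps. -/
noncomputable def wt (w : ℕ → ℤ → ℝ) : ℕ → (ℕ → ℤ) → ℝ
  | 0, f => w 0 (f 0)
  | n + 1, f => w (n + 1) (f 0) * wt w n (fun k => f (k + 1))

/-- Prepend a value to a trajectory. -/
def cons (x : ℤ) (f : ℕ → ℤ) : ℕ → ℤ
  | 0 => x
  | k + 1 => f k

/-- The displacement of a step. -/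
def mv (x : ℤ) (b : Bool) : ℤ := if b then x + 1 else x - 1

lemma Z_pos {w : ℕ → ℤ → ℝ} (hw : ∀ n x, 0 < w n x) : ∀ n x, 0 < Z w n x
  | 0, x => hw 0 x
  | n + 1, x => mul_pos (hw _ _) (add_pos (Z_pos hw n _) (Z_pos hw n _))

lemma wt_pos {w : ℕ → ℤ → ℝ} (hw : ∀ n x, 0 < w n x) : ∀ n f, 0 < wt w n f
  | 0, f => hw 0 _
  | n + 1, f => mul_pos (hw _ _) (wt_pos hw n _)

/-- One step of the Markov chain. -/
noncomputable def step {w : ℕ → ℤ → ℝ} (hw : ∀ n x, 0 < w n x) (n : ℕ) (x : ℤ) : PMF Bool :=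
  PMF.ofFintype (fun b => ENNReal.ofReal (Z w n (mv x b) / (Z w n (x + 1) + Z w n (x - 1)))) (by
    have h1 := Z_pos hw n (x + 1)
    have h2 := Z_pos hw n (x - 1)
    rw [Fintype.sum_bool, ← ENNReal.ofReal_add (by simp only [mv]; positivity)
      (by simp only [mv]; positivity), ← add_div]
    simp only [mv]
    simp [div_self (add_pos h1 h2).ne'])

/-- The Markov chain with `n` remaining steps started at `x`. -/
noncomputable def P {w : ℕ → ℤ → ℝ} (hw : ∀ n x, 0 < w n x) : ℕ → ℤ → PMF (ℕ → ℤ)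
  | 0, x => PMF.pure (fun _ => x)
  | n + 1, x => (step hw n x).bind fun b => (P hw n (mv x b)).map (cons x)

/-- Trajectories. -/
def isP : ℕ → ℤ → (ℕ → ℤ) → Prop
  | 0, x, f => f = fun _ => x
  | n + 1, x, f => ∃ b g, f = cons x g ∧ isP n (mv x b) g

lemma isP_zero : ∀ {n x f}, isP n x f → f 0 = x
  | 0, x, f, h => by rw [show f = fun _ => x from h]
  | n + 1, x, f, ⟨b, g, h, _⟩ => by rw [h]; rfl

lemma P_support {w : ℕ → ℤ → ℝ} (hw : ∀ n x, 0 < w n x) :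
    ∀ n x f, f ∈ (P hw n x).support → isP n x f
  | 0, x, f, h => by simpa [P, isP] using h
  | n + 1, x, f, h => by
    simp only [P, PMF.mem_support_bind_iff, PMF.mem_support_map_iff] at h
    obtain ⟨b, _, g, hg, rfl⟩ := h
    exact ⟨b, g, rfl, P_support hw n _ g hg⟩

lemma cons_inj (x : ℤ) : Function.Injective (cons x) := by
  intro f g h
  funext k
  exact congrFun h (k + 1)

lemma map_inj_apply {α β : Type*} (p : PMF α) (e : α → β) (he : Function.Injective e) (a : α) :
    (p.map e) (e a) = p a := by
  classical
  rw [PMF.map_apply, tsum_eq_single a]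
  · simp
  · intro b hb
    rw [if_neg]
    exact fun h => hb (he h.symm)

lemma P_apply {w : ℕ → ℤ → ℝ} (hw : ∀ n x, 0 < w n x) :
    ∀ n x f, isP n x f → P hw n x f = ENNReal.ofReal (wt w n f / Z w n x)
  | 0, x, f, h => by
    rw [show f = fun _ => x from h]
    simp [P, wt, Z, div_self (hw 0 x).ne']
  | n + 1, x, f, ⟨b, g, hf, hg⟩ => by
    have ih := P_apply hw n _ g hg
    have hS := add_pos (Z_pos hw n (x + 1)) (Z_pos hw n (x - 1))
    subst hf
    have h0 := isP_zero hg
    simp only [P, PMF.bind_apply, map_inj_apply _ _ (cons_inj x)]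
    rw [tsum_eq_single b, ih]
    · simp only [step, PMF.ofFintype_apply]
      have hz := Z_pos hw n (mv x b)
      rw [← ENNReal.ofReal_mul (by positivity)]
      congr 1
      have := hw (n + 1) x
      simp only [wt, Z, cons]
      field_simp
    · intro b' hb
      rw [mul_eq_zero]; right
      by_contra hne
      have h1 := isP_zero (P_support hw n _ g ((PMF.mem_support_iff _ _).2 hne))
      rw [h0] at h1
      cases b <;> cases b' <;> simp [mv] at h1 hb <;> omega

lemma Z_tp {w₁ w₂ : ℕ → ℤ → ℝ} (hw₁ : ∀ n x, 0 < w₁ n x) (hw₂ : ∀ n x, 0 < w₂ n x)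
    (h : ∀ n x y, y ≤ x → w₁ n y * w₂ n x ≤ w₁ n x * w₂ n y) :
    ∀ n x y, y ≤ x → (x - y) % 2 = 0 → Z w₁ n y * Z w₂ n x ≤ Z w₁ n x * Z w₂ n y
  | 0, x, y, hxy, _ => h 0 x y hxy
  | n + 1, x, y, hxy, hp => by
    rcases hxy.eq_or_lt with rfl | hlt
    · exact le_rfl
    have ih := Z_tp hw₁ hw₂ h n
    have a1 := ih (x + 1) (y + 1) (by omega) (by omega)
    have a2 := ih (x + 1) (y - 1) (by omega) (by omega)
    have a3 := ih (x - 1) (y + 1) (by omega) (by omega)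
    have a4 := ih (x - 1) (y - 1) (by omega) (by omega)
    have hh := h (n + 1) x y hxy
    have hs : (Z w₁ n (y + 1) + Z w₁ n (y - 1)) * (Z w₂ n (x + 1) + Z w₂ n (x - 1)) ≤
        (Z w₁ n (x + 1) + Z w₁ n (x - 1)) * (Z w₂ n (y + 1) + Z w₂ n (y - 1)) := by nlinarith
    simp only [Z]
    have p1 := Z_pos hw₁ n (y + 1)
    have p2 := Z_pos hw₁ n (y - 1)
    have p3 := Z_pos hw₂ n (x + 1)
    have p4 := Z_pos hw₂ n (x - 1)
    have q1 := hw₁ (n + 1) x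
    have q2 := hw₂ (n + 1) y
    calc _ = (w₁ (n + 1) y * w₂ (n + 1) x) *
        ((Z w₁ n (y + 1) + Z w₁ n (y - 1)) * (Z w₂ n (x + 1) + Z w₂ n (x - 1))) := by ring
      _ ≤ (w₁ (n + 1) x * w₂ (n + 1) y) *
        ((Z w₁ n (x + 1) + Z w₁ n (x - 1)) * (Z w₂ n (y + 1) + Z w₂ n (y - 1))) := by
          apply mul_le_mul hh hs <;> positivity
      _ = _ := by ring

lemma bool_coupling (p₁ p₂ : PMF Bool) (h : p₂ true ≤ p₁ true) :
    ∃ q : PMF (Bool × Bool), q.map Prod.fst = p₁ ∧ q.map Prod.snd = p₂ ∧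
      ∀ b ∈ q.support, b.2 ≤ b.1 := by
  have s1 : p₁ true + p₁ false = 1 := by
    have := p₁.tsum_coe; rwa [tsum_fintype, Fintype.sum_bool] at this
  have s2 : p₂ true + p₂ false = 1 := by
    have := p₂.tsum_coe; rwa [tsum_fintype, Fintype.sum_bool] at this
  have e1 : p₂ true + (p₁ true - p₂ true) = p₁ true := add_tsub_cancel_of_le h
  have e2 : p₁ true - p₂ true + p₁ false = p₂ false := by
    have : p₂ true + (p₁ true - p₂ true + p₁ false) = p₂ true + p₂ false := by
      rw [← add_assoc, e1, s1, s2]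
    exact (ENNReal.add_right_inj (p₂.apply_ne_top true)).1 this
  let g : Bool × Bool → ℝ≥0∞ := fun b =>
    match b with
    | (true, true) => p₂ true
    | (true, false) => p₁ true - p₂ true
    | (false, true) => 0
    | (false, false) => p₁ false
  refine ⟨PMF.ofFintype g ?_, ?_, ?_, ?_⟩
  · rw [Fintype.sum_prod_type]
    simp [g, e1, s1]
  · ext b
    rw [PMF.map_apply, tsum_fintype, Fintype.sum_prod_type]
    cases b <;> simp [g, e1]
  · ext b
    rw [PMF.map_apply, tsum_fintype, Fintype.sum_prod_type]
    cases b <;> simp [g, e2]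
  · rintro ⟨b, c⟩ hb
    cases b <;> cases c <;> simp [g] at hb ⊢

lemma step_coupling {w₁ w₂ : ℕ → ℤ → ℝ} (hw₁ : ∀ n x, 0 < w₁ n x) (hw₂ : ∀ n x, 0 < w₂ n x)
    (h : ∀ n x y, y ≤ x → w₁ n y * w₂ n x ≤ w₁ n x * w₂ n y) (n : ℕ) (x y : ℤ)
    (hxy : y ≤ x) (hp : (x - y) % 2 = 0) :
    ∃ q : PMF (Bool × Bool), q.map Prod.fst = step hw₁ n x ∧ q.map Prod.snd = step hw₂ n y ∧
      ∀ b ∈ q.support, mv y b.2 ≤ mv x b.1 := by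
  rcases hxy.eq_or_lt with rfl | hlt
  · obtain ⟨q, h1, h2, h3⟩ := bool_coupling (step hw₁ n y) (step hw₂ n y) (by
      simp only [step, PMF.ofFintype_apply, mv]
      apply ENNReal.ofReal_le_ofReal
      have p1 := Z_pos hw₁ n (y + 1)
      have p2 := Z_pos hw₁ n (y - 1)
      have p3 := Z_pos hw₂ n (y + 1)
      have p4 := Z_pos hw₂ n (y - 1)
      have := Z_tp hw₁ hw₂ h n (y + 1) (y - 1) (by omega) (by omega)
      simp only [if_true]
      rw [div_le_div_iff₀ (by positivity) (by positivity)]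
      nlinarith)
    refine ⟨q, h1, h2, ?_⟩
    rintro ⟨b, c⟩ hb
    have := h3 _ hb
    cases b <;> cases c
    · simp [mv]
    · exact absurd this (by decide)
    · simp only [mv]; simp; omega
    · simp [mv]
  · refine ⟨(step hw₁ n x).bind fun a => (step hw₂ n y).map fun b => (a, b), ?_, ?_, ?_⟩
    · rw [PMF.map_bind]
      simp only [PMF.map_comp, Function.comp_def]
      refine Eq.trans ?_ (PMF.bind_pure _)
      congr 1
      funext b
      exact PMF.map_const _ _
    · rw [PMF.map_bind]
      simp only [PMF.map_comp, Function.comp_def, PMF.bind_const]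
      exact PMF.map_id _
    · rintro ⟨b, c⟩ -
      cases b <;> cases c <;> simp [mv] <;> omega

lemma chain_coupling {w₁ w₂ : ℕ → ℤ → ℝ} (hw₁ : ∀ n x, 0 < w₁ n x) (hw₂ : ∀ n x, 0 < w₂ n x)
    (h : ∀ n x y, y ≤ x → w₁ n y * w₂ n x ≤ w₁ n x * w₂ n y) :
    ∀ (n : ℕ) (x y : ℤ), y ≤ x → (x - y) % 2 = 0 →
    ∃ q : PMF ((ℕ → ℤ) × (ℕ → ℤ)), q.map Prod.fst = P hw₁ n x ∧ q.map Prod.snd = P hw₂ n y ∧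
      ∀ f ∈ q.support, ∀ k, f.2 k ≤ f.1 k
  | 0, x, y, hxy, hp => by
    refine ⟨PMF.pure (fun _ => x, fun _ => y), ?_, ?_, ?_⟩
    · simp [PMF.pure_map, P]
    · simp [PMF.pure_map, P]
    · intro f hf k
      simp only [PMF.mem_support_pure_iff] at hf
      subst hf
      exact hxy
  | n + 1, x, y, hxy, hp => by
    obtain ⟨s, s1, s2, s3⟩ := step_coupling hw₁ hw₂ h n x y hxy hp
    have ih : ∀ b : Bool × Bool, ∃ q : PMF ((ℕ → ℤ) × (ℕ → ℤ)), b ∈ s.support →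
        (q.map Prod.fst = P hw₁ n (mv x b.1) ∧ q.map Prod.snd = P hw₂ n (mv y b.2) ∧
          ∀ f ∈ q.support, ∀ k, f.2 k ≤ f.1 k) := by
      intro b
      by_cases hb : b ∈ s.support
      · obtain ⟨q, hq⟩ := chain_coupling hw₁ hw₂ h n (mv x b.1) (mv y b.2) (s3 b hb) (by
          rcases b with ⟨b, c⟩
          cases b <;> cases c <;> simp [mv] <;> omega)
        exact ⟨q, fun _ => hq⟩
      · exact ⟨PMF.pure (fun _ => 0, fun _ => 0), fun h => absurd h hb⟩
    choose q hq using ih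
    have bc : ∀ {γ : Type} (F G : Bool × Bool → PMF γ), (∀ b ∈ s.support, F b = G b) →
        s.bind F = s.bind G := by
      intro γ F G hFG
      ext c
      simp only [PMF.bind_apply]
      refine tsum_congr fun b => ?_
      by_cases hb : b ∈ s.support
      · rw [hFG b hb]
      · rw [(PMF.apply_eq_zero_iff _ _).2 hb, zero_mul, zero_mul]
    refine ⟨s.bind fun b => (q b).map (Prod.map (cons x) (cons y)), ?_, ?_, ?_⟩
    · rw [PMF.map_bind, P, ← s1, PMF.bind_map]
      refine bc _ _ fun b hb => ?_
      simp only [Function.comp_apply]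
      rw [← (hq b hb).1, PMF.map_comp, PMF.map_comp]
      rfl
    · rw [PMF.map_bind, P, ← s2, PMF.bind_map]
      refine bc _ _ fun b hb => ?_
      simp only [Function.comp_apply]
      rw [← (hq b hb).2.1, PMF.map_comp, PMF.map_comp]
      rfl
    · intro f hf k
      simp only [PMF.mem_support_bind_iff, PMF.mem_support_map_iff] at hf
      obtain ⟨b, hb, g, hg, rfl⟩ := hf
      cases k with
      | zero => exact hxy
      | succ k => exact (hq b hb).2.2 g hg k

lemma isP_iff : ∀ n x f, isP n x f ↔ (f 0 = x ∧
    (∀ k < n, f (k + 1) - f k = 1 ∨ f (k + 1) - f k = -1) ∧ ∀ k, n ≤ k → f k = f n)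
  | 0, x, f => by
    constructor
    · intro h
      rw [show f = fun _ => x from h]
      simp
    · rintro ⟨h, -, h'⟩
      funext k
      rw [h' k (Nat.zero_le _), h]
  | n + 1, x, f => by
    constructor
    · rintro ⟨b, g, rfl, hg⟩
      obtain ⟨h0, h1, h2⟩ := (isP_iff n _ g).1 hg
      refine ⟨rfl, ?_, ?_⟩
      · rintro (_ | k) hk
        · simp only [cons, h0]
          cases b <;> simp [mv]
        · exact h1 k (by omega)
      · rintro (_ | k) hk
        · omega
        · exact h2 k (by omega)
    · rintro ⟨h0, h1, h2⟩
      have hf : f = cons x fun k => f (k + 1) := by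
        funext k
        cases k with
        | zero => exact h0
        | succ k => rfl
      have h10 := h1 0 (by omega)
      have key : ∀ b, f 1 = mv x b → isP (n + 1) x f := fun b hb =>
        ⟨b, _, hf, (isP_iff n _ _).2 ⟨hb, fun k hk => h1 (k + 1) (by omega),
          fun k hk => h2 (k + 1) (by omega)⟩⟩
      rw [h0] at h10
      simp only [zero_add] at h10
      rcases h10 with h | h
      · exact key true (by simp [mv]; omega)
      · exact key false (by simp [mv]; omega)

lemma pmf_eq_of_prop {α : Type*} (p q : PMF α) (C : ℝ≥0∞) (h : ∀ a, p a = C * q a) : p = q := by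
  have : C = 1 := by
    have h1 := p.tsum_coe
    simp_rw [h] at h1
    rwa [ENNReal.tsum_mul_left, q.tsum_coe, mul_one] at h1
  ext a
  rw [h, this, one_mul]

/-- The one-site weights. -/
noncomputable def ww (N L β ε κ : ℝ) : ℕ → ℤ → ℝ
  | 0, x => Real.exp (-β * max ((x : ℝ) / Real.sqrt N + ε) 0)
  | _ + 1, x => Real.exp (-((L / N) * Real.exp (-Real.sqrt L * ((x : ℝ) / Real.sqrt N + κ))))

lemma ww_pos (N L β ε κ : ℝ) : ∀ n x, 0 < ww N L β ε κ n x
  | 0, _ => Real.exp_pos _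
  | _ + 1, _ => Real.exp_pos _

lemma wt_ww (N L β ε κ : ℝ) : ∀ n f, wt (ww N L β ε κ) n f =
    Real.exp (-β * max ((f n : ℝ) / Real.sqrt N + ε) 0 -
    (L / N) * ∑ k ∈ Finset.range n,
      Real.exp (-Real.sqrt L * ((f k : ℝ) / Real.sqrt N + κ)))
  | 0, f => by simp [wt, ww]
  | n + 1, f => by
    rw [wt, wt_ww, ww, ← Real.exp_add, Finset.sum_range_succ']
    congr 1
    ring

lemma ww_tp (N L β ε κ₁ κ₂ : ℝ) (hL : 0 < L) (hN : 1 ≤ N) (hκ : κ₁ ≤ κ₂) :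
    ∀ n x y, y ≤ x → ww N L β ε κ₁ n y * ww N L β ε κ₂ n x ≤
      ww N L β ε κ₁ n x * ww N L β ε κ₂ n y
  | 0, x, y, _ => by simp only [ww]; rw [mul_comm]
  | n + 1, x, y, hxy => by
    simp only [ww]
    rw [← Real.exp_add, ← Real.exp_add, Real.exp_le_exp]
    have e : ∀ (z : ℤ) (κ : ℝ), Real.exp (-Real.sqrt L * ((z : ℝ) / Real.sqrt N + κ)) =
        Real.exp (-Real.sqrt L * ((z : ℝ) / Real.sqrt N)) * Real.exp (-Real.sqrt L * κ) := by
      intro z κ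
      rw [← Real.exp_add]; ring_nf
    simp only [e]
    have hxy' : (y : ℝ) / Real.sqrt N ≤ (x : ℝ) / Real.sqrt N := by
      have : (y : ℝ) ≤ x := by exact_mod_cast hxy
      gcongr
    have hs := Real.sqrt_nonneg L
    have h1 : Real.exp (-Real.sqrt L * ((x : ℝ) / Real.sqrt N)) ≤
        Real.exp (-Real.sqrt L * ((y : ℝ) / Real.sqrt N)) := by
      apply Real.exp_le_exp.2; nlinarith
    have h2 : Real.exp (-Real.sqrt L * κ₂) ≤ Real.exp (-Real.sqrt L * κ₁) := by
      apply Real.exp_le_exp.2; nlinarith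
    have h3 : 0 ≤ L / N := by positivity
    have h4 := mul_nonneg h3 (mul_nonneg (sub_nonneg.2 h1) (sub_nonneg.2 h2))
    nlinarith

/-- Re-indexing of paths. -/
def enc (A a : ℤ) (ℓ : {ℓ : ℤ → ℤ // IsPath A a ℓ}) : ℕ → ℤ := fun j => ℓ.val (A + j)

lemma enc_inj (A a : ℤ) : Function.Injective (enc A a) := by
  rintro ⟨f, hf⟩ ⟨g, hg⟩ h
  apply Subtype.ext
  funext k
  by_cases hk : k ≤ A
  · exact (hf.2.2.1 k hk).trans (hg.2.2.1 k hk).symm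
  · have := congrFun h (k - A).toNat
    simp only [enc] at this
    rwa [show A + ((k - A).toNat : ℤ) = k by omega] at this

lemma enc_isP (A a : ℤ) (hA : A < 0) (ℓ : {ℓ : ℤ → ℤ // IsPath A a ℓ}) :
    isP (-A).toNat a (enc A a ℓ) := by
  obtain ⟨f, h0, h1, h2, h3⟩ := ℓ
  rw [isP_iff]
  refine ⟨by simpa [enc] using h0, ?_, ?_⟩
  · intro k hk
    have := h1 (A + k) (by omega) (by omega)
    simp only [enc]
    rwa [show A + ((k + 1 : ℕ) : ℤ) = A + k + 1 by push_cast; ring]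
  · intro k hk
    simp only [enc]
    rw [h3 _ (by omega), h3 (A + ((-A).toNat : ℕ)) (by omega)]

lemma enc_surj (A a : ℤ) (hA : A < 0) (f : ℕ → ℤ) (hf : isP (-A).toNat a f) :
    ∃ ℓ, enc A a ℓ = f := by
  rw [isP_iff] at hf
  obtain ⟨h0, h1, h2⟩ := hf
  refine ⟨⟨fun k => f (k - A).toNat, ?_, ?_, ?_, ?_⟩, ?_⟩
  · simpa using h0
  · intro k hk hk'
    have := h1 (k - A).toNat (by omega)
    rwa [show (k - A).toNat + 1 = (k + 1 - A).toNat by omega] at this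
  · intro k hk
    simp only
    rw [show (k - A).toNat = 0 by omega, h0]
  · intro k hk
    simp only
    rw [h2 _ (by omega), h2 (0 - A).toNat (by omega)]
  · funext j
    simp [enc]

lemma wt_enc (N L β ε κ : ℝ) (A a : ℤ) (hA : A < 0) (ℓ : {ℓ : ℤ → ℤ // IsPath A a ℓ}) :
    wt (ww N L β ε κ) (-A).toNat (enc A a ℓ) = pathWeightBarrier N L β ε κ A ℓ.val := by
  rw [wt_ww, pathWeightBarrier]
  simp only [enc]
  rw [show A + (((-A).toNat : ℕ) : ℤ) = 0 by omega]
  congr 3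
  refine Finset.sum_bij' (fun j _ => A + (j : ℤ)) (fun k _ => (k - A).toNat) ?_ ?_ ?_ ?_ ?_
  · intro j hj
    simp only [Finset.mem_range, Finset.mem_Icc] at *
    omega
  · intro j hj
    simp only [Finset.mem_range, Finset.mem_Icc] at *
    omega
  · intro j hj
    simp
  · intro j hj
    simp only [Finset.mem_Icc] at hj
    omega
  · intro j hj
    rfl

lemma map_enc (N L β ε κ : ℝ) (A a : ℤ) (hA : A < 0) (μ : PMF {ℓ : ℤ → ℤ // IsPath A a ℓ})
    (h : ∃ c : ℝ, 0 < c ∧ ∀ ℓ, μ ℓ = ENNReal.ofReal (c * pathWeightBarrier N L β ε κ A ℓ.val)) :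
    P (ww_pos N L β ε κ) (-A).toNat a = μ.map (enc A a) := by
  obtain ⟨c, hc, h⟩ := h
  have hZ := Z_pos (ww_pos N L β ε κ) (-A).toNat a
  refine pmf_eq_of_prop _ _ (ENNReal.ofReal (1 / (c * Z (ww N L β ε κ) (-A).toNat a))) ?_
  intro f
  by_cases hf : isP (-A).toNat a f
  · obtain ⟨ℓ, rfl⟩ := enc_surj A a hA f hf
    rw [P_apply _ _ _ _ hf, map_inj_apply _ _ (enc_inj A a), h, wt_enc _ _ _ _ _ _ _ hA,
      ← ENNReal.ofReal_mul (by positivity)]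
    congr 1
    field_simp
  · have e1 : P (ww_pos N L β ε κ) (-A).toNat a f = 0 :=
      (PMF.apply_eq_zero_iff _ _).2 fun hh => hf (P_support _ _ _ _ hh)
    have e2 : (μ.map (enc A a)) f = 0 := by
      refine (PMF.apply_eq_zero_iff _ _).2 fun hh => hf ?_
      rw [PMF.mem_support_map_iff] at hh
      obtain ⟨ℓ, -, rfl⟩ := hh
      exact enc_isP A a hA ℓ
    rw [e1, e2, mul_zero]

end BarrierCoupling

/-- Discrete monotone coupling in the barrier height: if `0 ≤ κ₁ ≤ κ₂` and `μ^{ε,κᵢ}` is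
the probability measure on paths started at `a` proportional to `W^{ε,κᵢ}`, then there
is a coupling `ν` of `μ^{ε,κ₁}` and `μ^{ε,κ₂}` supported on pairs `(ℓ₁, ℓ₂)` with
`ℓ₁(k) ≥ ℓ₂(k)` for all `k ∈ {A,…,0}`. -/
theorem monotone_coupling_barrier (A : ℤ) (hA : A < 0) (L N : ℝ) (hL : 0 < L)
    (hN : 1 ≤ N) (a : ℤ) (β : ℝ) (hβ : 0 ≤ β) (ε : ℝ) (hε : 0 < ε)
    (κ₁ κ₂ : ℝ) (hκ₁ : 0 ≤ κ₁) (hκ : κ₁ ≤ κ₂)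
    (μ₁ μ₂ : PMF {ℓ : ℤ → ℤ // IsPath A a ℓ})
    (h₁ : ∃ c : ℝ, 0 < c ∧ ∀ ℓ, μ₁ ℓ = ENNReal.ofReal (c * pathWeightBarrier N L β ε κ₁ A ℓ.val))
    (h₂ : ∃ c : ℝ, 0 < c ∧ ∀ ℓ, μ₂ ℓ = ENNReal.ofReal (c * pathWeightBarrier N L β ε κ₂ A ℓ.val)) :
    ∃ ν : PMF ({ℓ : ℤ → ℤ // IsPath A a ℓ} × {ℓ : ℤ → ℤ // IsPath A a ℓ}),
      ν.map Prod.fst = μ₁ ∧ ν.map Prod.snd = μ₂ ∧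
      ∀ p ∈ ν.support, ∀ k : ℤ, A ≤ k → k ≤ 0 → p.2.val k ≤ p.1.val k := by
  classical
  open BarrierCoupling in
  obtain ⟨q, q1, q2, q3⟩ := chain_coupling (ww_pos N L β ε κ₁) (ww_pos N L β ε κ₂)
    (ww_tp N L β ε κ₁ κ₂ hL hN hκ) (-A).toNat a a le_rfl (by simp)
  rw [BarrierCoupling.map_enc N L β ε κ₁ A a hA μ₁ h₁] at q1
  rw [BarrierCoupling.map_enc N L β ε κ₂ A a hA μ₂ h₂] at q2
  obtain ⟨ℓ₀, -⟩ := μ₁.support_nonempty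
  have : Nonempty {ℓ : ℤ → ℤ // IsPath A a ℓ} := ⟨ℓ₀⟩
  have hinj := BarrierCoupling.enc_inj A a
  have hinv : Function.invFun (BarrierCoupling.enc A a) ∘ BarrierCoupling.enc A a = id :=
    Function.invFun_comp hinj
  refine ⟨q.map (Prod.map (Function.invFun (BarrierCoupling.enc A a))
    (Function.invFun (BarrierCoupling.enc A a))), ?_, ?_, ?_⟩
  · rw [PMF.map_comp, Prod.map_fst', ← PMF.map_comp, q1, PMF.map_comp, hinv, PMF.map_id]
  · rw [PMF.map_comp, Prod.map_snd', ← PMF.map_comp, q2, PMF.map_comp, hinv, PMF.map_id]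
  · intro p hp k hk hk'
    rw [PMF.mem_support_map_iff] at hp
    obtain ⟨⟨f, g⟩, hfg, rfl⟩ := hp
    have hf : f ∈ (μ₁.map (BarrierCoupling.enc A a)).support := by
      rw [← q1, PMF.mem_support_map_iff]; exact ⟨_, hfg, rfl⟩
    have hg : g ∈ (μ₂.map (BarrierCoupling.enc A a)).support := by
      rw [← q2, PMF.mem_support_map_iff]; exact ⟨_, hfg, rfl⟩
    rw [PMF.mem_support_map_iff] at hf hg
    obtain ⟨ℓ₁, -, rfl⟩ := hf
    obtain ⟨ℓ₂, -, rfl⟩ := hg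
    have := q3 _ hfg (k - A).toNat
    simp only [BarrierCoupling.enc] at this
    rw [show A + ((k - A).toNat : ℤ) = k by omega] at this
    have e1 := congrFun hinv ℓ₁
    have e2 := congrFun hinv ℓ₂
    simp only [Function.comp_apply, id] at e1 e2
    simp only [Prod.map_apply, e1, e2]
    exact this
end

section
/- For every R ≥ 1, every a ∈ [1/R, R], every γ ∈ (0, 1/2), and every y ≥ 0, one has γ^{−1/2} · (y/a) · (𝔭₁(y)/𝔭₁(a)) · (𝔭_{1−γ}(a − y√γ) − 𝔭_{1−γ}(a + y√γ)) ≤ (2^{3/2}/√(πe)) · y² · exp(−y²/2) · R / 𝔭₁(R). -/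
theorem aux_mul_exp (s u : ℝ) (hs : 0 < s) :
    |u| * Real.exp (-(u ^ 2) / (2 * s)) ≤ Real.sqrt s * Real.exp (-1 / 2) := by
  have hq : 0 < Real.sqrt s := Real.sqrt_pos.mpr hs
  have hq2 : Real.sqrt s ^ 2 = s := Real.sq_sqrt hs.le
  have h1 : |u| ≤ Real.sqrt s * ((u ^ 2 / s - 1) / 2 + 1) := by
    have h : Real.sqrt s * ((u ^ 2 / s - 1) / 2 + 1) - |u|
        = (|u| - Real.sqrt s) ^ 2 / (2 * Real.sqrt s) := by
      rw [← sq_abs u]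
      nth_rewrite 2 [← hq2]
      field_simp
      ring
    have : 0 ≤ (|u| - Real.sqrt s) ^ 2 / (2 * Real.sqrt s) := by positivity
    linarith
  have h2 := Real.add_one_le_exp ((u ^ 2 / s - 1) / 2)
  have h3 : |u| ≤ Real.sqrt s * Real.exp ((u ^ 2 / s - 1) / 2) :=
    h1.trans (mul_le_mul_of_nonneg_left h2 hq.le)
  calc |u| * Real.exp (-(u ^ 2) / (2 * s))
      ≤ Real.sqrt s * Real.exp ((u ^ 2 / s - 1) / 2) * Real.exp (-(u ^ 2) / (2 * s)) :=
        mul_le_mul_of_nonneg_right h3 (Real.exp_pos _).le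
    _ = Real.sqrt s * Real.exp (-1 / 2) := by
        rw [mul_assoc, ← Real.exp_add]
        congr 2
        field_simp
        ring

theorem aux_lip (s : ℝ) (hs : 0 < s) (u v : ℝ) :
    |Real.exp (-(u ^ 2) / (2 * s)) - Real.exp (-(v ^ 2) / (2 * s))|
      ≤ Real.exp (-1 / 2) / Real.sqrt s * |u - v| := by
  have hd : ∀ x ∈ (Set.univ : Set ℝ), HasDerivWithinAt
      (fun x : ℝ => Real.exp (-(x ^ 2) / (2 * s)))
      (Real.exp (-(x ^ 2) / (2 * s)) * (-(2 * x) / (2 * s))) Set.univ x := by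
    intro x _
    have := (((hasDerivAt_pow 2 x).neg).div_const (2 * s)).exp
    simpa using this
  have hb : ∀ x ∈ (Set.univ : Set ℝ),
      ‖Real.exp (-(x ^ 2) / (2 * s)) * (-(2 * x) / (2 * s))‖
        ≤ Real.exp (-1 / 2) / Real.sqrt s := by
    intro x _
    have h := aux_mul_exp s x hs
    have hq : 0 < Real.sqrt s := Real.sqrt_pos.mpr hs
    have hq2 : Real.sqrt s * Real.sqrt s = s := Real.mul_self_sqrt hs.le
    have e : ‖Real.exp (-(x ^ 2) / (2 * s)) * (-(2 * x) / (2 * s))‖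
        = |x| * Real.exp (-(x ^ 2) / (2 * s)) / s := by
      rw [norm_mul, Real.norm_eq_abs, Real.norm_eq_abs, Real.abs_exp, abs_div, abs_neg,
        abs_mul, abs_mul, abs_of_pos hs, abs_two]
      field_simp
    rw [e, div_le_div_iff₀ hs hq]
    calc _ ≤ Real.sqrt s * Real.exp (-1 / 2) * Real.sqrt s :=
          mul_le_mul_of_nonneg_right h hq.le
      _ = Real.exp (-1 / 2) * s := by rw [← hq2]; ring_nf; simp [hs.le]
  have := Convex.norm_image_sub_le_of_norm_hasDerivWithin_le hd hb convex_univ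
    (Set.mem_univ v) (Set.mem_univ u)
  simpa [Real.norm_eq_abs] using this

theorem aux_const : (2 : ℝ) ^ ((3 : ℝ) / 2) / Real.sqrt (Real.pi * Real.exp 1)
    = 4 * Real.exp (-1 / 2) / Real.sqrt (2 * Real.pi) := by
  have h1 : (2 : ℝ) ^ ((3 : ℝ) / 2) = 2 * Real.sqrt 2 := by
    rw [show (3 : ℝ) / 2 = 1 + 1 / 2 by norm_num, Real.rpow_add two_pos, Real.rpow_one,
      Real.sqrt_eq_rpow]
  have h2 : Real.sqrt (Real.exp 1) = Real.exp (1 / 2) := (Real.exp_half 1).symm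
  have h3 : Real.exp (-1 / 2) = (Real.exp (1 / 2))⁻¹ := by
    rw [← Real.exp_neg]; norm_num
  have hp : 0 < Real.sqrt Real.pi := Real.sqrt_pos.mpr Real.pi_pos
  have hq : 0 < Real.sqrt 2 := by positivity
  have hq2 : Real.sqrt 2 ^ 2 = 2 := Real.sq_sqrt two_pos.le
  rw [h1, Real.sqrt_mul Real.pi_pos.le, Real.sqrt_mul two_pos.le, h2, h3]
  field_simp
  rw [hq2]; norm_num

theorem aux_kernel (s : ℝ) (hs : 1 / 2 ≤ s) (a h : ℝ) (hh : 0 ≤ h) :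
    heatKernel s (a - h) - heatKernel s (a + h)
      ≤ (2 : ℝ) ^ ((3 : ℝ) / 2) / Real.sqrt (Real.pi * Real.exp 1) * h := by
  have hs0 : 0 < s := by linarith
  have hl := (le_abs_self _).trans (aux_lip s hs0 (a - h) (a + h))
  have e1 : |a - h - (a + h)| = 2 * h := by
    rw [show a - h - (a + h) = -(2 * h) by ring, abs_neg, abs_of_nonneg (by linarith)]
  rw [e1] at hl
  have hq : 0 < Real.sqrt s := Real.sqrt_pos.mpr hs0
  have hq2 : Real.sqrt s ^ 2 = s := Real.sq_sqrt hs0.le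
  have hp : 0 < Real.sqrt (2 * Real.pi) := Real.sqrt_pos.mpr (by positivity)
  rw [aux_const]
  unfold heatKernel
  rw [← mul_sub, Real.sqrt_mul (by positivity)]
  calc _ ≤ (Real.sqrt (2 * Real.pi) * Real.sqrt s)⁻¹ *
        (Real.exp (-1 / 2) / Real.sqrt s * (2 * h)) :=
        mul_le_mul_of_nonneg_left hl (by positivity)
    _ = (2 * Real.exp (-1 / 2) * h / Real.sqrt (2 * Real.pi)) * (1 / s) := by
        nth_rewrite 3 [← hq2]
        field_simp
    _ ≤ (2 * Real.exp (-1 / 2) * h / Real.sqrt (2 * Real.pi)) * 2 := by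
        apply mul_le_mul_of_nonneg_left _ (by positivity)
        rw [div_le_iff₀ hs0]; linarith
    _ = _ := by ring

theorem bridge_endpoint_density_bound (R : ℝ) (hR : 1 ≤ R) (a : ℝ)
    (ha : a ∈ Set.Icc (1 / R) R) (γ : ℝ) (hγ : γ ∈ Set.Ioo (0 : ℝ) (1 / 2))
    (y : ℝ) (hy : 0 ≤ y) :
    (Real.sqrt γ)⁻¹ * (y / a) * (heatKernel 1 y / heatKernel 1 a) *
        (heatKernel (1 - γ) (a - y * Real.sqrt γ) - heatKernel (1 - γ) (a + y * Real.sqrt γ))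
      ≤ (2 : ℝ) ^ ((3 : ℝ) / 2) / Real.sqrt (Real.pi * Real.exp 1) *
          (y ^ 2 * Real.exp (-y ^ 2 / 2)) * R / heatKernel 1 R := by
  obtain ⟨ha1, ha2⟩ := ha
  obtain ⟨hg1, hg2⟩ := hγ
  have hR0 : 0 < R := by linarith
  have ha0 : 0 < a := lt_of_lt_of_le (by positivity) ha1
  have hsg : 0 < Real.sqrt γ := Real.sqrt_pos.mpr hg1
  have hpos : ∀ u, 0 < heatKernel 1 u := by
    intro u
    have := Real.pi_pos
    unfold heatKernel
    positivity
  have hk := aux_kernel (1 - γ) (by linarith) a (y * Real.sqrt γ) (by positivity)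
  have hC : 0 ≤ (2 : ℝ) ^ ((3 : ℝ) / 2) / Real.sqrt (Real.pi * Real.exp 1) := by positivity
  generalize (2 : ℝ) ^ ((3 : ℝ) / 2) / Real.sqrt (Real.pi * Real.exp 1) = C at *
  have hinv : 1 / a ≤ R := by
    rw [div_le_iff₀ hR0] at ha1
    rw [div_le_iff₀ ha0]; linarith
  have hmono : heatKernel 1 R ≤ heatKernel 1 a := by
    unfold heatKernel
    apply mul_le_mul_of_nonneg_left _ (by positivity)
    apply Real.exp_le_exp.mpr
    nlinarith
  have hy1 : heatKernel 1 y ≤ Real.exp (-y ^ 2 / 2) := by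
    unfold heatKernel
    rw [mul_one, mul_one]
    have : (Real.sqrt (2 * Real.pi))⁻¹ ≤ 1 := by
      apply inv_le_one_of_one_le₀
      rw [Real.one_le_sqrt]
      linarith [Real.pi_gt_three]
    exact mul_le_of_le_one_left (Real.exp_pos _).le this
  have hya := hpos y
  have haa := hpos a
  have hra := hpos R
  calc _ ≤ (Real.sqrt γ)⁻¹ * (y / a) * (heatKernel 1 y / heatKernel 1 a) *
        (C * (y * Real.sqrt γ)) := mul_le_mul_of_nonneg_left hk (by positivity)
    _ = C * (y ^ 2 * heatKernel 1 y) * (1 / a) / heatKernel 1 a := by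
        field_simp
    _ ≤ _ := by gcongr
end

section
/- For every s > 0 and every y > 0, lim_{β→∞} ∫₀^∞ (β/2) · e^{−v} · (𝔭_s(v/β − y) − 𝔭_s(v/β + y)) dv = (y/s) · 𝔭_s(y). -/
open MeasureTheory Filter

/-- Dominated-convergence limit identifying the `β → ∞` limit of the finite-dimensional
densities of drifted Brownian motion conditioned to stay positive:
`lim_{β→∞} ∫₀^∞ (β/2) e^{−v} (𝔭_s(v/β − y) − 𝔭_s(v/β + y)) dv = (y/s) 𝔭_s(y)`. -/
theorem drift_limit_integral (s y : ℝ) (hs : 0 < s) (hy : 0 < y) :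
    Tendsto (fun β : ℝ =>
        ∫ v in Set.Ioi (0 : ℝ),
          β / 2 * Real.exp (-v) * (heatKernel s (v / β - y) - heatKernel s (v / β + y)))
      atTop (nhds (y / s * heatKernel s y)) := by
  have hmain : ∀ c : ℝ, 0 ≤ c → c = (Real.sqrt (2 * Real.pi * s))⁻¹ → Tendsto (fun β : ℝ =>
        ∫ v in Set.Ioi (0 : ℝ),
          β / 2 * Real.exp (-v) * (heatKernel s (v / β - y) - heatKernel s (v / β + y)))
      atTop (nhds (∫ v in Set.Ioi (0 : ℝ),
        (y / s * heatKernel s y) * (Real.exp (-v) * v ^ ((2:ℝ) - 1)))) := by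
    intro c hc hce
    have hint := Real.GammaIntegral_convergent (s := 2) (by norm_num)
    refine tendsto_integral_filter_of_dominated_convergence
      (fun v => (c * (y / s)) * (Real.exp (-v) * v ^ ((2:ℝ) - 1))) ?_ ?_ (hint.const_mul _) ?_
    · refine Eventually.of_forall fun β => ?_
      refine Continuous.aestronglyMeasurable ?_
      unfold heatKernel
      fun_prop
    · filter_upwards [eventually_gt_atTop 0] with β hβ
      refine (ae_restrict_iff' measurableSet_Ioi).2 (Eventually.of_forall fun v hv => ?_)
      have hv' : 0 < v := hv
      have e1 : heatKernel s (v / β + y)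
          = heatKernel s (v / β - y) * Real.exp (-(2 * (v / β) * y / s)) := by
        unfold heatKernel
        rw [mul_assoc (Real.sqrt _)⁻¹, ← Real.exp_add]
        congr 2
        field_simp
        ring
      have e2 : heatKernel s (v / β - y) ≤ c := by
        unfold heatKernel
        rw [← hce]
        apply mul_le_of_le_one_right hc
        rw [Real.exp_le_one_iff]
        exact div_nonpos_of_nonpos_of_nonneg (by nlinarith [sq_nonneg (v / β - y)]) (by positivity)
      have e0 : 0 ≤ heatKernel s (v / β - y) := by
        unfold heatKernel
        positivity
      have e3 := Real.add_one_le_exp (-(2 * (v / β) * y / s))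
      have e4 : Real.exp (-(2 * (v / β) * y / s)) ≤ 1 := by
        rw [Real.exp_le_one_iff, neg_nonpos]
        positivity
      have e5 : heatKernel s (v / β - y) - heatKernel s (v / β + y)
          = heatKernel s (v / β - y) * (1 - Real.exp (-(2 * (v / β) * y / s))) := by
        rw [e1]; ring
      have e6 : heatKernel s (v / β - y) * (1 - Real.exp (-(2 * (v / β) * y / s)))
          ≤ c * (2 * (v / β) * y / s) :=
        mul_le_mul e2 (by linarith) (by linarith) hc
      have e7 : 0 ≤ heatKernel s (v / β - y) * (1 - Real.exp (-(2 * (v / β) * y / s))) :=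
        mul_nonneg e0 (by linarith)
      rw [e5, Real.norm_of_nonneg (mul_nonneg (by positivity) e7)]
      refine (mul_le_mul_of_nonneg_left e6 (by positivity)).trans (le_of_eq ?_)
      norm_num
      field_simp
    · refine Eventually.of_forall fun v => ?_
      have hk : ∀ u, HasDerivAt (heatKernel s) (-(u / s) * heatKernel s u) u := by
        intro u
        have h := ((((hasDerivAt_id u).pow 2).neg.div_const (2 * s)).exp).const_mul
          (Real.sqrt (2 * Real.pi * s))⁻¹
        refine h.congr_deriv ?_
        simp [heatKernel]
        field_simp
      have ha : HasDerivAt (fun t : ℝ => t * v - y) v 0 := by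
        simpa using ((hasDerivAt_id (0:ℝ)).mul_const v).sub_const y
      have hb : HasDerivAt (fun t : ℝ => t * v + y) v 0 := by
        simpa using ((hasDerivAt_id (0:ℝ)).mul_const v).add_const y
      have hd := ((hk _).comp (0:ℝ) ha).sub ((hk _).comp (0:ℝ) hb)
      have ht := (hd.tendsto_slope_zero_right.comp tendsto_inv_atTop_nhdsGT_zero).const_mul
        (Real.exp (-v) / 2)
      have hev : heatKernel s (-y) = heatKernel s y := by simp [heatKernel]
      refine (ht.congr ?_).trans (le_of_eq ?_)
      · intro β
        simp [hev, div_eq_inv_mul]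
        ring
      · congr 1
        norm_num [hev]
        ring
  have h := hmain _ (by positivity) rfl
  rwa [integral_const_mul, ← Real.Gamma_eq_integral (by norm_num), Real.Gamma_two, mul_one] at h
end

section
/- Let A < 0 be real. For each integer N ≥ 1 let f_N, g_N : [A, 0] → ℝ be continuous, and suppose f_N → f and g_N → g uniformly on [A, 0] for some continuous f, g : [A, 0] → ℝ. Extend every function h : [A, 0] → ℝ to ℝ by h(x) := h(A) for x < A and h(x) := h(0) for x > 0. Then lim_{N→∞} N^{−1/2} · ∑_{k=0}^{⌊−A√N/2⌋} [ exp(g_N(−2k/√N) − f_N(−2k/√N + N^{−1/2})) + exp(g_N(−2k/√N) − f_N(−2k/√N − N^{−1/2})) ] = ∫_A^0 exp(g(x) − f(x)) dx. -/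
open Filter

/-- Extension of a function `h : [A,0] → ℝ` to all of `ℝ` by `h(A)` to the left of `A`
and `h(0)` to the right of `0`. -/
noncomputable def clampIcc (A : ℝ) (h : ℝ → ℝ) (x : ℝ) : ℝ :=
  h (max A (min x 0))

lemma clamp_mem (A : ℝ) (hA : A < 0) (x : ℝ) : max A (min x 0) ∈ Set.Icc A 0 :=
  ⟨le_max_left _ _, max_le hA.le (min_le_right _ _)⟩

lemma clamp_eq (A : ℝ) (h : ℝ → ℝ) (x : ℝ) (hx : x ∈ Set.Icc A 0) : clampIcc A h x = h x := by
  unfold clampIcc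
  rw [min_eq_left hx.2, max_eq_right hx.1]

lemma clamp_dist (A x y : ℝ) : |max A (min x 0) - max A (min y 0)| ≤ |x - y| := by
  have h : LipschitzWith 1 (fun x : ℝ => max A (min x 0)) :=
    (LipschitzWith.id.min_const 0).const_max A
  simpa [Real.dist_eq] using h.dist_le_mul x y

lemma clamp_uc (A : ℝ) (hA : A < 0) (f : ℝ → ℝ) (hf : ContinuousOn f (Set.Icc A 0))
    (ε : ℝ) (hε : 0 < ε) :
    ∃ δ > 0, ∀ x y : ℝ, |x - y| < δ → |clampIcc A f x - clampIcc A f y| < ε := by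
  have h := isCompact_Icc.uniformContinuousOn_of_continuous hf
  rw [Metric.uniformContinuousOn_iff] at h
  obtain ⟨δ, hδ, h⟩ := h ε hε
  refine ⟨δ, hδ, fun x y hxy => ?_⟩
  have := h _ (clamp_mem A hA x) _ (clamp_mem A hA y)
    (by rw [Real.dist_eq]; exact (clamp_dist A x y).trans_lt hxy)
  simpa [Real.dist_eq, clampIcc] using this

lemma clamp_cont (A : ℝ) (hA : A < 0) (f : ℝ → ℝ) (hf : ContinuousOn f (Set.Icc A 0)) :
    Continuous (clampIcc A f) :=
  hf.comp_continuous (by fun_prop) (clamp_mem A hA)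

lemma sqrt_inv_tendsto : Tendsto (fun N : ℕ => (Real.sqrt N)⁻¹) atTop (nhds 0) :=
  tendsto_inv_atTop_zero.comp (Real.tendsto_sqrt_atTop.comp tendsto_natCast_atTop_atTop)

lemma key (A : ℝ) (hA : A < 0)
    (f g : ℝ → ℝ) (fN gN : ℕ → ℝ → ℝ)
    (hfc : ContinuousOn f (Set.Icc A 0)) (hgc : ContinuousOn g (Set.Icc A 0))
    (hfu : TendstoUniformlyOn fN f atTop (Set.Icc A 0))
    (hgu : TendstoUniformlyOn gN g atTop (Set.Icc A 0))
    (M : ℝ) (hM : ∀ x, Real.exp (clampIcc A g x - clampIcc A f x) ≤ M)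
    (ε : ℝ) (hε : 0 < ε) :
    ∀ᶠ N : ℕ in atTop, ∀ x y z : ℝ, |y - x| ≤ 2 * (Real.sqrt N)⁻¹ →
      |z - x| ≤ 3 * (Real.sqrt N)⁻¹ →
      |Real.exp (clampIcc A (gN N) y - clampIcc A (fN N) z) -
        Real.exp (clampIcc A g x - clampIcc A f x)| ≤ ε := by
  have hM0 : 0 < M := (Real.exp_pos _).trans_le (hM 0)
  obtain ⟨η, hη, hη1, hη2⟩ : ∃ η > 0, 4 * η ≤ 1 ∧ M * (2 * (4 * η)) ≤ ε := by
    refine ⟨min (1/4) (ε / (8 * M)), by positivity, ?_, ?_⟩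
    · linarith [min_le_left (1/4) (ε / (8 * M))]
    · have := min_le_right (1/4) (ε / (8 * M))
      rw [le_div_iff₀ (by positivity)] at this
      linarith
  obtain ⟨δ₁, hδ₁, hf1⟩ := clamp_uc A hA f hfc η hη
  obtain ⟨δ₂, hδ₂, hg1⟩ := clamp_uc A hA g hgc η hη
  rw [Metric.tendstoUniformlyOn_iff] at hfu hgu
  filter_upwards [hfu η hη, hgu η hη,
    sqrt_inv_tendsto.eventually_lt_const (show (0:ℝ) < δ₁ / 3 by positivity),
    sqrt_inv_tendsto.eventually_lt_const (show (0:ℝ) < δ₂ / 3 by positivity)]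
    with N h1 h2 h3 h4 x y z hy hz
  have h5 := h1 _ (clamp_mem A hA z)
  have h6 := h2 _ (clamp_mem A hA y)
  have h0 : 0 ≤ (Real.sqrt N)⁻¹ := by positivity
  have h7 := hf1 z x (by linarith)
  have h8 := hg1 y x (by linarith)
  rw [Real.dist_eq] at h5 h6
  change |clampIcc A f z - clampIcc A (fN N) z| < η at h5
  change |clampIcc A g y - clampIcc A (gN N) y| < η at h6
  have hd : |(clampIcc A (gN N) y - clampIcc A (fN N) z) - (clampIcc A g x - clampIcc A f x)|
      ≤ 4 * η := by
    rw [abs_lt] at h5 h6 h7 h8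
    rw [abs_le]
    constructor <;> linarith [h5.1, h5.2, h6.1, h6.2, h7.1, h7.2, h8.1, h8.2]
  set a := clampIcc A (gN N) y - clampIcc A (fN N) z
  have hMx := hM x
  set b := clampIcc A g x - clampIcc A f x
  have e : Real.exp a - Real.exp b = Real.exp b * (Real.exp (a - b) - 1) := by
    rw [mul_sub, ← Real.exp_add]; ring_nf
  rw [e, abs_mul, abs_of_pos (Real.exp_pos b)]
  calc _ ≤ M * (2 * (4 * η)) := by
        gcongr
        exact (Real.abs_exp_sub_one_le (hd.trans hη1)).trans (by linarith)
    _ ≤ ε := hη2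

/-- Riemann-sum convergence for the exponents of the discrete Radon–Nikodym derivatives
of the half-space log-gamma Gibbs measures: if `f_N → f` and `g_N → g` uniformly on
`[A,0]` (all continuous on `[A,0]`, extended constantly outside), then
`N^{−1/2} ∑_{k=0}^{⌊−A√N/2⌋} [exp(g_N(−2k/√N) − f_N(−2k/√N + N^{−1/2}))
  + exp(g_N(−2k/√N) − f_N(−2k/√N − N^{−1/2}))] → ∫_A^0 exp(g(x) − f(x)) dx`. -/
theorem riemann_sum_gibbs_exponent (A : ℝ) (hA : A < 0)
    (f g : ℝ → ℝ) (fN gN : ℕ → ℝ → ℝ)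
    (hfNc : ∀ N, ContinuousOn (fN N) (Set.Icc A 0))
    (hgNc : ∀ N, ContinuousOn (gN N) (Set.Icc A 0))
    (hfc : ContinuousOn f (Set.Icc A 0)) (hgc : ContinuousOn g (Set.Icc A 0))
    (hfu : TendstoUniformlyOn fN f atTop (Set.Icc A 0))
    (hgu : TendstoUniformlyOn gN g atTop (Set.Icc A 0)) :
    Tendsto (fun N : ℕ =>
        (Real.sqrt N)⁻¹ * ∑ k ∈ Finset.range (⌊-A * Real.sqrt N / 2⌋₊ + 1),
          (Real.exp (clampIcc A (gN N) (-2 * k / Real.sqrt N) -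
              clampIcc A (fN N) (-2 * k / Real.sqrt N + (Real.sqrt N)⁻¹)) +
            Real.exp (clampIcc A (gN N) (-2 * k / Real.sqrt N) -
              clampIcc A (fN N) (-2 * k / Real.sqrt N - (Real.sqrt N)⁻¹))))
      atTop (nhds (∫ x in A..0, Real.exp (g x - f x))) := by
  have hFc := clamp_cont A hA f hfc
  have hGc := clamp_cont A hA g hgc
  set H : ℝ → ℝ := fun x => Real.exp (clampIcc A g x - clampIcc A f x) with hH
  have hHc : Continuous H := by fun_prop
  obtain ⟨M, hM⟩ : ∃ M, ∀ x, H x ≤ M := by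
    obtain ⟨C, hC⟩ := isCompact_Icc.exists_bound_of_continuousOn
      (f := fun x => Real.exp (g x - f x)) ((hgc.sub hfc).rexp)
    exact ⟨C, fun x => (le_abs_self _).trans (hC _ (clamp_mem A hA x))⟩
  have hM0 : 0 < M := (Real.exp_pos _).trans_le (hM 0)
  have hI : ∫ x in A..0, Real.exp (g x - f x) = ∫ x in A..0, H x := by
    apply intervalIntegral.integral_congr
    intro x hx
    rw [Set.uIcc_of_le hA.le] at hx
    simp only [hH, clamp_eq A _ x hx]
  rw [hI, Metric.tendsto_nhds]
  intro ε hε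
  have hε' : 0 < ε / (2 * (-A + 2)) := div_pos hε (by linarith)
  have hev := key A hA f g fN gN hfc hgc hfu hgu M hM _ hε'
  filter_upwards [hev, eventually_ge_atTop 1,
    sqrt_inv_tendsto.eventually_lt_const (show (0:ℝ) < 1 by norm_num),
    sqrt_inv_tendsto.eventually_lt_const (show (0:ℝ) < ε / (4 * M) by positivity)]
    with N hk hN1 hs1 hs2
  have hs : 0 < Real.sqrt N := Real.sqrt_pos.2 (by exact_mod_cast hN1)
  set η := ε / (2 * (-A + 2)) with hηdef
  set s := Real.sqrt N
  have hsi : 0 < s⁻¹ := inv_pos.2 hs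
  set n := ⌊-A * s / 2⌋₊ with hn
  let a : ℕ → ℝ := fun k => -2 * k / s
  have hstep : ∀ k, a (k + 1) = a k - 2 * s⁻¹ := by
    intro k; simp only [a]; push_cast; field_simp; ring
  have hn1 : (n : ℝ) ≤ -A * s / 2 := Nat.floor_le (by nlinarith)
  have hn2 : -A * s / 2 < n + 1 := Nat.lt_floor_add_one _
  have han : A ≤ a n := by
    simp only [a]; rw [le_div_iff₀ hs]; linarith
  have han1 : a (n + 1) ≤ A := by
    simp only [a]; rw [div_le_iff₀ hs]; push_cast; linarith
  have hint : ∀ u v, IntervalIntegrable H MeasureTheory.volume u v :=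
    fun u v => hHc.intervalIntegrable u v
  have hsum : ∑ k ∈ Finset.range (n + 1), ∫ x in a k..a (k + 1), H x
      = ∫ x in (0:ℝ)..a (n + 1), H x := by
    rw [intervalIntegral.sum_integral_adjacent_intervals (fun k _ => hint _ _)]
    simp [a]
  have hsplit : ∫ x in A..0, H x = -(∫ x in (0:ℝ)..a (n + 1), H x) + ∫ x in A..a (n + 1), H x := by
    rw [← intervalIntegral.integral_symm,
      add_comm, intervalIntegral.integral_add_adjacent_intervals (hint _ _) (hint _ _)]
  have htail : |∫ x in A..a (n + 1), H x| ≤ M * (2 * s⁻¹) := by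
    have := intervalIntegral.norm_integral_le_of_norm_le_const (a := A) (b := a (n + 1))
      (f := H) (C := M)
      (fun x _ => by rw [Real.norm_eq_abs, abs_of_pos (Real.exp_pos _)]; exact hM x)
    rw [Real.norm_eq_abs] at this
    refine this.trans (mul_le_mul_of_nonneg_left ?_ hM0.le)
    rw [abs_of_nonpos (by linarith)]
    linarith [hstep n]
  have hterm : ∀ k : ℕ, |s⁻¹ * (Real.exp (clampIcc A (gN N) (-2 * k / s) -
              clampIcc A (fN N) (-2 * k / s + s⁻¹)) +
            Real.exp (clampIcc A (gN N) (-2 * k / s) -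
              clampIcc A (fN N) (-2 * k / s - s⁻¹))) + ∫ x in a k..a (k + 1), H x|
        ≤ η * (2 * s⁻¹) := by
    intro k
    change |s⁻¹ * (Real.exp (clampIcc A (gN N) (a k) - clampIcc A (fN N) (a k + s⁻¹)) +
            Real.exp (clampIcc A (gN N) (a k) -
              clampIcc A (fN N) (a k - s⁻¹))) + _| ≤ _
    have hb : ∀ x ∈ Set.uIoc (a k) (a (k + 1)), a k - 2 * s⁻¹ ≤ x ∧ x ≤ a k := by
      intro x hx
      rw [Set.uIoc_of_ge (by linarith [hstep k]), hstep k] at hx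
      exact ⟨hx.1.le, hx.2⟩
    have h1 : ∀ x ∈ Set.uIoc (a k) (a (k + 1)), _ := fun x hx =>
      hk x (a k) (a k + s⁻¹)
        (by have := hb x hx; rw [abs_le]; constructor <;> linarith [this.1, this.2])
        (by have := hb x hx; rw [abs_le]; constructor <;> linarith [this.1, this.2])
    have h2 : ∀ x ∈ Set.uIoc (a k) (a (k + 1)), _ := fun x hx =>
      hk x (a k) (a k - s⁻¹)
        (by have := hb x hx; rw [abs_le]; constructor <;> linarith [this.1, this.2])
        (by have := hb x hx; rw [abs_le]; constructor <;> linarith [this.1, this.2])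
    generalize Real.exp (clampIcc A (gN N) (a k) - clampIcc A (fN N) (a k + s⁻¹)) = e1 at *
    generalize Real.exp (clampIcc A (gN N) (a k) - clampIcc A (fN N) (a k - s⁻¹)) = e2 at *
    have h3 := intervalIntegral.norm_integral_le_of_norm_le_const (a := a k) (b := a (k + 1))
      (f := fun x => H x - (e1 + e2) / 2) (C := η) (fun x hx => by
        have p := abs_le.1 (h1 x hx)
        have q := abs_le.1 (h2 x hx)
        change (_ ≤ e1 - H x) ∧ (e1 - H x ≤ _) at p
        change (_ ≤ e2 - H x) ∧ (e2 - H x ≤ _) at q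
        rw [Real.norm_eq_abs, abs_le]
        constructor <;> linarith [p.1, p.2, q.1, q.2])
    rw [intervalIntegral.integral_sub (hint _ _) (by simp), intervalIntegral.integral_const,
      hstep k, Real.norm_eq_abs, smul_eq_mul] at h3
    have e3 : |a k - 2 * s⁻¹ - a k| = 2 * s⁻¹ := by
      rw [abs_of_nonpos (by linarith)]; ring
    rw [e3] at h3
    rw [hstep k]
    convert h3 using 2
    ring
  rw [Real.dist_eq, hsplit, ← hsum, Finset.mul_sum, sub_add_eq_sub_sub, sub_neg_eq_add,
    ← Finset.sum_add_distrib]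
  have hS := (Finset.abs_sum_le_sum_abs _ _).trans
    (Finset.sum_le_sum (fun k (_ : k ∈ Finset.range (n + 1)) => hterm k))
  rw [Finset.sum_const, Finset.card_range, nsmul_eq_mul] at hS
  have hlen : ((n + 1 : ℕ) : ℝ) * (η * (2 * s⁻¹)) < η * (-A + 2) := by
    have : ((n + 1 : ℕ) : ℝ) * (2 * s⁻¹) < -A + 2 := by
      have h4 : (n : ℝ) * s⁻¹ ≤ -A / 2 := by
        rw [← div_eq_mul_inv, div_le_iff₀ hs]; linarith
      push_cast; linarith
    calc _ = η * (((n + 1 : ℕ) : ℝ) * (2 * s⁻¹)) := by ring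
      _ < _ := mul_lt_mul_of_pos_left this hε'
  have hη2 : η * (-A + 2) = ε / 2 := by
    have : -A + 2 ≠ 0 := by linarith
    rw [hηdef]; field_simp
  have hT : M * (2 * s⁻¹) < ε / 2 := by
    rw [lt_div_iff₀ (by positivity)] at hs2
    linarith
  refine (abs_sub _ _).trans_lt ?_
  linarith
end

section
/- For every C > 0, every real N ≥ 1, and every real x ≤ −2C², one has N^{−1/2} · ∑_{k=1}^{∞} exp(−(k − x√N)²/(C·N) + C·k/√N) ≤ exp(C·x) · ∫_{−x}^{∞} exp(−w²/C + C·w) dw; moreover, the right-hand side tends to 0 as x → −∞. -/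
open MeasureTheory Filter

lemma aux_g_integrable (C : ℝ) (hC : 0 < C) :
    Integrable (fun w : ℝ => Real.exp (-w ^ 2 / C + C * w)) := by
  have h := ((integrable_exp_neg_mul_sq (b := 1 / C) (by positivity)).comp_sub_right
    (C ^ 2 / 2)).const_mul (Real.exp (C ^ 3 / 4))
  refine h.congr (Filter.Eventually.of_forall fun w => ?_)
  simp only
  rw [← Real.exp_add]
  congr 1
  field_simp
  ring

/-- Sum-to-integral comparison and vanishing of the Gaussian tail: for every `C > 0`,
`N ≥ 1`, and `x ≤ −2C²`,
`N^{−1/2} ∑_{k=1}^∞ exp(−(k − x√N)²/(CN) + Ck/√N) ≤ e^{Cx} ∫_{−x}^∞ e^{−w²/C + Cw} dw`,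
and the right-hand side tends to `0` as `x → −∞`. -/
theorem sum_integral_comparison_tail (C : ℝ) (hC : 0 < C) :
    (∀ N : ℝ, 1 ≤ N → ∀ x : ℝ, x ≤ -2 * C ^ 2 →
      (Real.sqrt N)⁻¹ *
          ∑' k : ℕ, Real.exp (-((k : ℝ) + 1 - x * Real.sqrt N) ^ 2 / (C * N) +
            C * ((k : ℝ) + 1) / Real.sqrt N)
        ≤ Real.exp (C * x) * ∫ w in Set.Ioi (-x), Real.exp (-w ^ 2 / C + C * w)) ∧
    Tendsto (fun x : ℝ =>
        Real.exp (C * x) * ∫ w in Set.Ioi (-x), Real.exp (-w ^ 2 / C + C * w))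
      atBot (nhds 0) := by
  have hg := aux_g_integrable C hC
  set g : ℝ → ℝ := fun w => Real.exp (-w ^ 2 / C + C * w) with hgdef
  constructor
  · intro N hN x hx
    have hs : 0 < Real.sqrt N := Real.sqrt_pos.2 (by linarith)
    have hsq : Real.sqrt N ^ 2 = N := Real.sq_sqrt (by linarith)
    generalize Real.sqrt N = s at hs hsq
    subst hsq
    set f : ℝ → ℝ := fun t => Real.exp (C * x) * g (s⁻¹ * t + -x) with hf
    have hfi : Integrable f :=
      ((hg.comp_add_right (-x)).comp_mul_left' (inv_ne_zero hs.ne')).const_mul _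
    have hC2 : 0 < C ^ 2 := by positivity
    have hanti : AntitoneOn f (Set.Ici 0) := by
      intro a ha b hb hab
      simp only [hf, hgdef]
      refine mul_le_mul_of_nonneg_left (Real.exp_le_exp.2 ?_) (Real.exp_pos _).le
      have ha' : 0 ≤ s⁻¹ * a := mul_nonneg (by positivity) ha
      have hab' : s⁻¹ * a ≤ s⁻¹ * b := mul_le_mul_of_nonneg_left hab (by positivity)
      generalize s⁻¹ * a = u at *
      generalize s⁻¹ * b = v at *
      have key : (-(v + -x) ^ 2 / C + C * (v + -x)) - (-(u + -x) ^ 2 / C + C * (u + -x))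
          = -((v - u) * (u + v - 2 * x - C ^ 2)) / C := by
        field_simp
        ring
      have : -((v - u) * (u + v - 2 * x - C ^ 2)) / C ≤ 0 := by
        apply div_nonpos_of_nonpos_of_nonneg _ hC.le
        have := mul_nonneg (sub_nonneg.2 hab') (show 0 ≤ u + v - 2 * x - C ^ 2 by linarith)
        linarith
      linarith
    have hpos : ∀ t, 0 ≤ f t := fun t => by positivity
    have hint : ∫ t in Set.Ioi (0:ℝ), f t = Real.exp (C * x) * (s * ∫ w in Set.Ioi (-x), g w) := by
      simp only [hf]
      rw [integral_const_mul]
      have h1 := integral_comp_mul_left_Ioi (fun t => g (t + -x)) 0 (inv_pos.2 hs)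
      have h2 : ∫ t in Set.Ioi (0:ℝ), g (t + -x) = ∫ w in Set.Ioi (-x), g w := by
        have h3 := (measurePreserving_add_right (volume : Measure ℝ) (-x)).setIntegral_preimage_emb
          (measurableEmbedding_addRight (-x)) g (Set.Ioi (-x))
        rw [← h3]
        congr 2
        ext t
        simp
      rw [mul_zero] at h1
      rw [h1, h2, inv_inv, smul_eq_mul]
    have hsum : ∀ k : ℕ, Real.exp (-((k : ℝ) + 1 - x * s) ^ 2 / (C * s ^ 2) +
            C * ((k : ℝ) + 1) / s) = f (k + 1) := by
      intro k
      simp only [hf, hgdef]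
      rw [← Real.exp_add]
      congr 1
      field_simp
      ring
    have hle := hanti.tsum_add_one_le_integral hfi.integrableOn (fun t _ => hpos t)
    rw [hint] at hle
    simp_rw [hsum]
    rw [inv_mul_le_iff₀ hs]
    push_cast at hle
    linarith
  · have hlim : Tendsto (fun x : ℝ => Real.exp (C * x) * ∫ w, g w) atBot (nhds 0) := by
      have : Tendsto (fun x : ℝ => Real.exp (C * x)) atBot (nhds 0) :=
        Real.tendsto_exp_atBot.comp (tendsto_id.const_mul_atBot hC)
      simpa using this.mul_const (∫ w, g w)
    refine squeeze_zero (fun x => ?_) (fun x => ?_) hlim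
    · exact mul_nonneg (Real.exp_pos _).le (integral_nonneg fun w => (Real.exp_pos _).le)
    · exact mul_le_mul_of_nonneg_left
        (setIntegral_le_integral hg (Eventually.of_forall fun w => (Real.exp_pos _).le))
        (Real.exp_pos _).le
end
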